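/- arXiv:1307.4203 — 2 statements merged into one kernel-verified Lean document; each statement's English description precedes it below -/
import Mathlib

section
/- Let G ⊆ ℂ be a simply connected domain whose boundary contains more than one point, and let ψ be a univalent analytic map from the open unit disk D onto G. If ψ extends continuously to the closed unit disk, then the set ∂ₛₙG of semi-unreachable boundary points of G is empty. -/
/-- `J` is a crosscut of `G`: `J = γ((0,1))` for a continuous injective
`γ : [0,1] → ℂ` with `γ((0,1)) ⊆ G` and endpoints `γ 0, γ 1 ∈ ∂G`. -/
def IsCrosscut (G J : Set ℂ) : Prop :=
  ∃ γ : ℝ → ℂ, ContinuousOn γ (Set.Icc 0 1) ∧ Set.InjOn γ (Set.Icc 0 1) ∧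
    J = γ '' Set.Ioo 0 1 ∧ J ⊆ G ∧ γ 0 ∈ frontier G ∧ γ 1 ∈ frontier G

/-- The set `∂ₐG` of accessible boundary points of `G`. -/
def accessiblePts (G : Set ℂ) : Set ℂ :=
  {a | a ∈ frontier G ∧ ∃ γ : ℝ → ℂ, ContinuousOn γ (Set.Icc 0 1) ∧
    Set.InjOn γ (Set.Icc 0 1) ∧ γ '' Set.Ico 0 1 ⊆ G ∧ γ 1 = a}

/-- The set `∂ₙG = ∂G \ ∂ₐG` of non-accessible boundary points of `G`. -/
def nonAccessiblePts (G : Set ℂ) : Set ℂ := frontier G \ accessiblePts G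

/-- The set `∂ₛₙG` of semi-unreachable boundary points of `G`. -/
def semiUnreachablePts (G : Set ℂ) : Set ℂ :=
  {a | a ∈ frontier G ∧ ∃ J U V : Set ℂ, IsCrosscut G J ∧
    IsOpen U ∧ IsOpen V ∧ IsConnected U ∧ IsConnected V ∧ Disjoint U V ∧
    G \ J = U ∪ V ∧ a ∈ (nonAccessiblePts U ∪ nonAccessiblePts V) \ J}

/-- `ψ` extends continuously to the closed unit disk. -/
def ExtendsContinuously (ψ : ℂ → ℂ) : Prop :=
  ∃ Ψ : ℂ → ℂ, ContinuousOn Ψ (Metric.closedBall (0 : ℂ) 1) ∧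
    Set.EqOn Ψ ψ (Metric.ball (0 : ℂ) 1)

open Set Metric Filter Topology

/-- A nowhere vanishing continuous function on a contractible, locally path connected space has a
continuous logarithm. -/
lemma exists_continuous_exp_eq {X : Type*} [TopologicalSpace X] [LocallyPathConnectedSpace X]
    [ContractibleSpace X] {f : X → ℂ} (hf : Continuous f) (h0 : ∀ x, f x ≠ 0) :
    ∃ g : X → ℂ, Continuous g ∧ ∀ x, Complex.exp (g x) = f x := by
  have hs : IsSimplyConnected (univ : Set X) := by
    have := (Homeomorph.Set.univ X).contractibleSpace
    exact inferInstanceAs (SimplyConnectedSpace (univ : Set X))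
  obtain ⟨g, hg, hgf⟩ := Complex.exists_continuousOn_eqOn_exp_comp hs isOpen_univ
    hf.continuousOn (by simpa using h0)
  exact ⟨g, continuousOn_univ.1 hg, fun x => hgf (mem_univ x)⟩

/-- The function `z ↦ z - p` has no continuous logarithm on a circle around `p`. -/
lemma not_exp_eq_sub_on_circle {L : ℂ → ℂ} (hL : Continuous L) {p : ℂ} {R : ℝ} (hR : 0 < R) :
    ¬ ∀ z, ‖z - p‖ = R → Complex.exp (L z) = z - p := by
  intro h
  let c : ℝ → ℂ := fun θ => p + R * Complex.exp (θ * Complex.I)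
  have hc : Continuous c := by fun_prop
  have hcn : ∀ θ, ‖c θ - p‖ = R := fun θ => by
    simp [c, Complex.norm_exp_ofReal_mul_I, abs_of_pos hR]
  have hexp : ∀ θ : ℝ, Complex.exp (L (c θ) - θ * Complex.I) = R := fun θ => by
    rw [Complex.exp_sub, h _ (hcn θ)]
    simp [c]
  have key : ∀ θ : ℝ, L (c θ) - θ * Complex.I = L (c 0) - (0 : ℝ) * Complex.I := by
    intro θ
    have := Complex.isCoveringMap_exp.eq_of_comp_eq (g₁ := fun θ : ℝ => L (c θ) - θ * Complex.I)
      (g₂ := fun _ : ℝ => L (c 0) - (0 : ℝ) * Complex.I) (by fun_prop) (by fun_prop)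
      (by
        funext θ
        apply Subtype.ext
        simp only [Function.comp]
        rw [hexp θ, hexp 0]) 0 rfl
    exact congrFun this θ
  have h2 := key (2 * Real.pi)
  have hcc : c (2 * Real.pi) = c 0 := by simp [c]
  rw [hcc] at h2
  simp [Real.pi_ne_zero, Complex.I_ne_zero] at h2

/-- An arc does not contain the frontier of a nonempty bounded set of the plane disjoint
from it. -/
lemma not_frontier_subset_arc {δ : ℝ → ℂ} (hc : ContinuousOn δ (Icc 0 1))
    (hi : InjOn δ (Icc 0 1)) {W : Set ℂ} (hWb : Bornology.IsBounded W)
    (hne : W.Nonempty) (hdis : Disjoint W (δ '' Icc 0 1)) : ¬ frontier W ⊆ δ '' Icc 0 1 := by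
  classical
  intro hfr
  obtain ⟨p, hp⟩ := hne
  have hpK : p ∉ δ '' Icc 0 1 := hdis.notMem_of_mem_left hp
  obtain ⟨R, hR0, hR⟩ := hWb.subset_ball_lt 0 p
  let e : C(Icc (0 : ℝ) 1, ℂ) := ⟨(Icc (0 : ℝ) 1).domRestrict δ, hc.domRestrict⟩
  have hee : IsClosedEmbedding e := e.continuous.isClosedEmbedding hi.injective
  have hnz : ∀ t : Icc (0 : ℝ) 1, e t - p ≠ 0 := fun t ht =>
    hpK ⟨t, t.2, sub_eq_zero.1 ht⟩
  obtain ⟨l, hlc, hl⟩ := exists_continuous_exp_eq (X := ℝ)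
    (f := fun t => e (projIcc 0 1 zero_le_one t) - p)
    ((e.continuous.comp continuous_projIcc).sub continuous_const) fun t => hnz _
  obtain ⟨L, hL⟩ := ContinuousMap.exists_extension' hee
    (⟨fun t => l t, hlc.comp continuous_subtype_val⟩ : C(Icc (0 : ℝ) 1, ℂ))
  have hLK : ∀ z ∈ δ '' Icc 0 1, Complex.exp (L z) = z - p := by
    rintro _ ⟨t, ht, rfl⟩
    have := congrFun hL ⟨t, ht⟩
    have h3 := hl t
    rw [projIcc_of_mem zero_le_one ht] at h3
    simp only [Function.comp_apply, ContinuousMap.coe_mk] at this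
    rw [← this] at h3
    exact h3
  let F : ℂ → ℂ := W.piecewise (fun z => Complex.exp (L z)) (fun z => z - p)
  have hF : Continuous F := by
    refine Continuous.piecewise (fun z hz => hLK z (hfr hz)) (by fun_prop) (by fun_prop)
  have hF0 : ∀ z, F z ≠ 0 := by
    intro z
    by_cases hz : z ∈ W
    · simp [F, hz]
    · simp only [F, hz, not_false_eq_true, piecewise_eq_of_notMem]
      intro h0
      exact hz (sub_eq_zero.1 h0 ▸ hp)
  obtain ⟨M, hMc, hM⟩ := exists_continuous_exp_eq hF hF0
  refine not_exp_eq_sub_on_circle hMc hR0 (p := p) fun z hz => ?_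
  rw [hM]
  refine piecewise_eq_of_notMem _ _ _ fun hzW => ?_
  have := hR hzW
  rw [mem_ball, dist_eq_norm] at this
  linarith

/-- The set of cluster points, at a left endpoint, of a continuous map from an open interval into
a compact set is preconnected. -/
lemma isPreconnected_setOf_mapClusterPt {X : Type*} [TopologicalSpace X] [T2Space X]
    [NormalSpace X] {K : Set X} (hK : IsCompact K) {f : ℝ → X} (hf : ContinuousOn f (Ioo 0 1))
    (hfK : MapsTo f (Ioo 0 1) K) : IsPreconnected {x | MapClusterPt x (𝓝[>] (0 : ℝ)) f} := by
  have hI : Ioo (0 : ℝ) 1 ∈ 𝓝[>] (0 : ℝ) := Ioo_mem_nhdsGT one_pos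
  have hcl : IsClosed {x | MapClusterPt x (𝓝[>] (0 : ℝ)) f} := isClosed_setOfPred_clusterPt
  rw [isPreconnected_iff_subset_of_fully_disjoint_closed hcl]
  intro a b ha hb hab hdis
  obtain ⟨u, v, hu, hv, hau, hbv, huv⟩ := normal_separation ha hb hdis
  have htend := hK.tendsto_nhdsSet_of_mapClusterPt (mem_of_superset hI hfK)
    (s' := {x | MapClusterPt x (𝓝[>] (0 : ℝ)) f}) (fun x _ hx => hx)
  have hev : ∀ᶠ t in 𝓝[>] (0 : ℝ), f t ∈ u ∪ v :=
    htend ((hu.union hv).mem_nhdsSet.2 (hab.trans (union_subset_union hau hbv)))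
  obtain ⟨ε, hε, hsub⟩ := mem_nhdsGT_iff_exists_Ioo_subset.1 (inter_mem hev hI)
  have hIε : Ioo 0 ε ∈ 𝓝[>] (0 : ℝ) := Ioo_mem_nhdsGT hε
  have hpre : IsPreconnected (f '' Ioo 0 ε) :=
    isPreconnected_Ioo.image _ (hf.mono fun t ht => (hsub ht).2)
  have hnot : ∀ u v : Set X, IsOpen v → Disjoint u v → f '' Ioo 0 ε ⊆ u →
      ∀ x ∈ v, ¬ MapClusterPt x (𝓝[>] (0 : ℝ)) f := by
    intro u v hv huv hfu x hxv hx
    obtain ⟨t, htv, ht⟩ :=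
      ((mapClusterPt_iff_frequently.1 hx v (hv.mem_nhds hxv)).and_eventually hIε).exists
    exact huv.le_bot ⟨hfu ⟨t, ht, rfl⟩, htv⟩
  have himg : f '' Ioo 0 ε ⊆ u ∪ v := by
    rintro _ ⟨t, ht, rfl⟩
    exact (hsub ht).1
  rcases isPreconnected_iff_subset_of_disjoint.1 hpre u v hu hv himg
    (by rw [huv.inter_eq, inter_empty]) with h | h
  · exact Or.inl fun x hx => (hab hx).resolve_right fun hxb => hnot u v hv huv h x (hbv hxb) hx
  · exact Or.inr fun x hx => (hab hx).resolve_left fun hxa =>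
      hnot v u hu huv.symm h x (hau hxa) hx

/-- A univalent function on the disk which extends continuously to the closed disk is not constant
on any arc of the unit circle. -/
lemma not_forall_eq_on_arc {Ψ : ℂ → ℂ} (hΨ : DiffContOnCl ℂ Ψ (ball 0 1))
    (hinj : InjOn Ψ (ball 0 1)) {a b : ℝ} (hab : a < b) {w c : ℂ} (hw : ‖w‖ = 1) :
    ¬ ∀ α ∈ Icc a b, Ψ (w * Complex.exp (α * Complex.I)) = c := by
  intro hconst
  obtain ⟨n, hn⟩ := exists_nat_gt (2 * Real.pi / (b - a))
  have hba : 0 < b - a := sub_pos.2 hab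
  have hn0 : (0 : ℝ) < n := lt_trans (div_pos Real.two_pi_pos hba) hn
  have hnba : 2 * Real.pi / n < b - a := by
    rw [div_lt_iff₀ hba] at hn
    rw [div_lt_iff₀ hn0]
    linarith
  let ζ : ℕ → ℂ := fun k => Complex.exp ((2 * Real.pi * k / n : ℝ) * Complex.I)
  have hζ : ∀ k, ‖ζ k‖ = 1 := fun k => Complex.norm_exp_ofReal_mul_I _
  have hcl : closure (ball (0 : ℂ) 1) = closedBall 0 1 := closure_ball 0 one_ne_zero
  let F : ℂ → ℂ := fun z => ∏ k ∈ Finset.range n, (Ψ (z * ζ k) - c)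
  have hmb : ∀ k, MapsTo (fun z => z * ζ k) (ball 0 1) (ball 0 1) := fun k z hz => by
    simpa [hζ k] using hz
  have hmc : ∀ k, MapsTo (fun z => z * ζ k) (closure (ball 0 1)) (closure (ball 0 1)) :=
    fun k z hz => by
      rw [hcl] at hz ⊢
      simpa [hζ k] using hz
  have hF : DiffContOnCl ℂ F (ball 0 1) :=
    ⟨DifferentiableOn.fun_finsetProd fun k _ =>
        (hΨ.differentiableOn.comp (by fun_prop) (hmb k)).sub_const c,
      continuousOn_finsetProd _ fun k _ =>
        (hΨ.continuousOn.comp (by fun_prop) (hmc k)).sub continuousOn_const⟩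
  have hF0 : EqOn F 0 (ball 0 1) := by
    refine Complex.eqOn_of_eqOn_frontier isBounded_ball hF diffContOnCl_const ?_
    intro z hz
    rw [frontier_ball 0 one_ne_zero, mem_sphere_zero_iff_norm] at hz
    have hw0 : w ≠ 0 := norm_ne_zero_iff.1 (by rw [hw]; exact one_ne_zero)
    set β : ℝ := Complex.arg (z / w)
    have hzβ : z = w * Complex.exp (β * Complex.I) := by
      have := Complex.norm_mul_exp_arg_mul_I (z / w)
      rw [norm_div, hz, hw, div_one, Complex.ofReal_one, one_mul] at this
      rw [this, mul_div_cancel₀ _ hw0]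
    set N : ℤ := ⌈(a - β) * n / (2 * Real.pi)⌉
    have hN1 : (a - β) * n / (2 * Real.pi) ≤ N := Int.le_ceil _
    have hN2 : (N : ℝ) < (a - β) * n / (2 * Real.pi) + 1 := Int.ceil_lt_add_one _
    have hnpos : (0 : ℤ) < n := by exact_mod_cast hn0
    have hmem : β + 2 * Real.pi * N / n ∈ Icc a b := by
      have e1 : 2 * Real.pi / n * ((a - β) * n / (2 * Real.pi)) = a - β := by
        field_simp
      have hp : 0 < 2 * Real.pi / n := div_pos Real.two_pi_pos hn0
      have e2 : 2 * Real.pi * N / n = 2 * Real.pi / n * N := by ring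
      have := mul_le_mul_of_nonneg_left hN1 hp.le
      have := mul_le_mul_of_nonneg_left hN2.le hp.le
      rw [e2]
      constructor <;> linarith
    have hk0 : 0 ≤ N % n := Int.emod_nonneg _ hnpos.ne'
    have hkn : N % n < n := Int.emod_lt_of_pos _ hnpos
    obtain ⟨k, hk⟩ := Int.eq_ofNat_of_zero_le hk0
    refine Finset.prod_eq_zero (i := k) (Finset.mem_range.2 (by omega)) ?_
    have hNk : (N : ℂ) = n * (N / n : ℤ) + k := by
      have := Int.mul_ediv_add_emod N n
      rw [hk] at this
      exact_mod_cast this.symm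
    have hnC : (n : ℂ) ≠ 0 := by exact_mod_cast hn0.ne'
    rw [sub_eq_zero, ← hconst _ hmem, hzβ, mul_assoc]
    congr 2
    rw [← Complex.exp_add, Complex.exp_eq_exp_iff_exists_int]
    refine ⟨-(N / n), ?_⟩
    push_cast
    rw [hNk]
    field_simp
    ring
  have hfin : (ball (0 : ℂ) 1) ⊆ ⋃ k ∈ Finset.range n, {z ∈ ball (0 : ℂ) 1 | Ψ (z * ζ k) = c} := by
    intro z hz
    obtain ⟨k, hk, h⟩ := Finset.prod_eq_zero_iff.1 (hF0 hz)
    exact mem_biUnion hk ⟨hz, sub_eq_zero.1 h⟩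
  have hsub : ∀ k, ({z ∈ ball (0 : ℂ) 1 | Ψ (z * ζ k) = c}).Subsingleton := by
    intro k x hx y hy
    have := hinj (hmb k hx.1) (hmb k hy.1) (hx.2.trans hy.2.symm)
    exact mul_right_cancel₀ (Complex.exp_ne_zero _) this
  have : (ball (0 : ℂ) 1).Finite :=
    (Set.Finite.biUnion (Finset.finite_toSet _) fun k _ => (hsub k).finite).subset hfin
  exact infinite_of_mem_nhds (0 : ℂ) (ball_mem_nhds 0 one_pos) this

/-- A preconnected subset of the unit circle on which a univalent function of the disk,
continuous on the closed disk, is constant is a subsingleton. -/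
lemma subsingleton_of_isPreconnected_of_eq {Ψ : ℂ → ℂ} (hΨ : DiffContOnCl ℂ Ψ (ball 0 1))
    (hinj : InjOn Ψ (ball 0 1)) {C : Set ℂ} (hC : IsPreconnected C) (hC1 : C ⊆ sphere 0 1)
    {c : ℂ} (hc : ∀ z ∈ C, Ψ z = c) : C.Subsingleton := by
  by_contra hns
  by_cases hw : sphere (0 : ℂ) 1 ⊆ C
  · exact not_forall_eq_on_arc hΨ hinj zero_lt_one (w := 1) (c := c) (by simp) fun α _ =>
      hc _ (hw (by simp [Complex.norm_exp_ofReal_mul_I]))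
  obtain ⟨w, hw1, hwC⟩ := not_subset.1 hw
  rw [mem_sphere_zero_iff_norm] at hw1
  have hw0 : w ≠ 0 := norm_ne_zero_iff.1 (by rw [hw1]; exact one_ne_zero)
  have harg : ∀ z ∈ C, -w * Complex.exp ((Complex.arg (z / -w) : ℝ) * Complex.I) = z := by
    intro z hz
    have hz1 : ‖z‖ = 1 := mem_sphere_zero_iff_norm.1 (hC1 hz)
    have := Complex.norm_mul_exp_arg_mul_I (z / -w)
    rw [norm_div, norm_neg, hz1, hw1, div_one, Complex.ofReal_one, one_mul] at this
    rw [this, mul_div_cancel₀ _ (neg_ne_zero.2 hw0)]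
  have hcont : ContinuousOn (fun z => Complex.arg (z / -w)) C := by
    intro z hz
    refine ContinuousAt.continuousWithinAt ?_
    refine (Complex.continuousAt_arg ?_).comp (by fun_prop)
    rw [Complex.mem_slitPlane_iff_arg]
    have hz1 : ‖z‖ = 1 := mem_sphere_zero_iff_norm.1 (hC1 hz)
    refine ⟨fun h => hwC ?_, ?_⟩
    · have := harg z hz
      rw [h, Complex.exp_pi_mul_I] at this
      simp only [mul_neg, mul_one, neg_neg] at this
      rwa [this]
    · exact div_ne_zero (norm_ne_zero_iff.1 (by rw [hz1]; exact one_ne_zero)) (neg_ne_zero.2 hw0)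
  obtain ⟨x, hx, y, hy, hxy⟩ := not_subsingleton_iff.1 hns
  have hne : Complex.arg (x / -w) ≠ Complex.arg (y / -w) := fun h => hxy (by
    rw [← harg x hx, ← harg y hy, h])
  have hord := (hC.image _ hcont).ordConnected
  have main : ∀ x ∈ C, ∀ y ∈ C, ¬ Complex.arg (x / -w) < Complex.arg (y / -w) := by
    intro x hx y hy hlt
    refine not_forall_eq_on_arc hΨ hinj hlt (w := -w) (c := c) (by simpa using hw1) fun α hα => ?_
    obtain ⟨z, hz, hzα⟩ := hord.out (mem_image_of_mem _ hx) (mem_image_of_mem _ hy) hα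
    have := harg z hz
    rw [show Complex.arg (z / -w) = α from hzα] at this
    rw [this]
    exact hc z hz
  rcases hne.lt_or_gt with h | h
  · exact main x hx y hy h
  · exact main y hy x hx h

/-- If `U` and `V` are disjoint open sets filling the unit disk off the closed set `K`, then `U`
contains the part of the disk close to any point of its closure on the circle which is not
in `K`. -/
lemma ball_inter_ball_subset_left {K U V : Set ℂ} (hU : IsOpen U)
    (hV : IsOpen V) (hdis : Disjoint U V) (hUV : ball (0 : ℂ) 1 \ K = U ∪ V) {w : ℂ} {r : ℝ}
    (hr : 0 < r) (hrK : Disjoint (ball w r) K) (hw : w ∈ closure U) :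
    ball w r ∩ ball 0 1 ⊆ U := by
  have hpre : IsPreconnected (ball w r ∩ ball (0 : ℂ) 1) :=
    ((convex_ball w r).inter (convex_ball 0 1)).isPreconnected
  refine hpre.subset_left_of_subset_union hU hV hdis ?_ ?_
  · rw [← hUV]
    exact fun z hz => ⟨hz.2, hrK.notMem_of_mem_left hz.1⟩
  · obtain ⟨u, hu, huU⟩ := mem_closure_iff.1 hw _ isOpen_ball (mem_ball_self hr)
    have : u ∈ ball (0 : ℂ) 1 \ K := hUV ▸ Or.inl huU
    exact ⟨u, ⟨hu, this.1⟩, huU⟩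

/-- Among the two arcs of the unit circle from `z` to `w`, one avoids `z'`. -/
lemma exists_arc_avoiding {z z' w : ℂ} (hz : ‖z‖ = 1) (hw : ‖w‖ = 1) (hwz : w ≠ z)
    (hwz' : w ≠ z') : ∃ θ : ℝ, θ ≠ 0 ∧ |θ| < 2 * Real.pi ∧
      w = z * Complex.exp (θ * Complex.I) ∧
      ∀ s ∈ Ioc (0 : ℝ) 1, z * Complex.exp ((s * θ : ℝ) * Complex.I) ≠ z' := by
  have hz0 : z ≠ 0 := norm_ne_zero_iff.1 (by rw [hz]; exact one_ne_zero)
  have hpi := Real.pi_pos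
  have hwarg : w = z * Complex.exp ((Complex.arg (w / z) : ℝ) * Complex.I) := by
    have := Complex.norm_mul_exp_arg_mul_I (w / z)
    rw [norm_div, hz, hw, div_one, Complex.ofReal_one, one_mul] at this
    rw [this, mul_div_cancel₀ _ hz0]
  have hper : ∀ θ : ℝ, Complex.exp ((θ + 2 * Real.pi : ℝ) * Complex.I) =
      Complex.exp (θ * Complex.I) := fun θ => by
    push_cast
    rw [add_mul, Complex.exp_add, Complex.exp_two_pi_mul_I, mul_one]
  obtain ⟨θ, hθ0, hθ1, hwθ⟩ : ∃ θ : ℝ, 0 < θ ∧ θ < 2 * Real.pi ∧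
      w = z * Complex.exp (θ * Complex.I) := by
    have h1 := Complex.neg_pi_lt_arg (w / z)
    have h2 := Complex.arg_le_pi (w / z)
    rcases lt_trichotomy (Complex.arg (w / z)) 0 with h | h | h
    · exact ⟨Complex.arg (w / z) + 2 * Real.pi, by linarith, by linarith, by rwa [hper]⟩
    · exact absurd (by simpa [h] using hwarg) hwz
    · exact ⟨Complex.arg (w / z), h, by linarith, hwarg⟩
  by_cases hgood : ∀ s ∈ Ioc (0 : ℝ) 1, z * Complex.exp ((s * θ : ℝ) * Complex.I) ≠ z'
  · exact ⟨θ, hθ0.ne', by rwa [abs_of_pos hθ0], hwθ, hgood⟩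
  push Not at hgood
  obtain ⟨s, hs, hsz⟩ := hgood
  have hs1 : s < 1 := lt_of_le_of_ne hs.2 fun h => hwz' (by rw [← hsz, h, one_mul]; exact hwθ)
  have hθ' : θ - 2 * Real.pi < 0 := by linarith
  refine ⟨θ - 2 * Real.pi, hθ'.ne, ?_, ?_, ?_⟩
  · rw [abs_of_neg hθ']
    linarith
  · rw [← hper, sub_add_cancel]
    exact hwθ
  · intro t ht htz
    rw [← hsz] at htz
    obtain ⟨m, hm⟩ := Complex.exp_eq_exp_iff_exists_int.1 (mul_left_cancel₀ hz0 htz)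
    have hm' : t * (θ - 2 * Real.pi) = s * θ + m * (2 * Real.pi) := by
      have hI : ((t * (θ - 2 * Real.pi) : ℝ) : ℂ) * Complex.I =
          ((s * θ + m * (2 * Real.pi) : ℝ) : ℂ) * Complex.I := by
        rw [hm]
        push_cast
        ring
      exact_mod_cast mul_right_cancel₀ Complex.I_ne_zero hI
    have h1 : t * (θ - 2 * Real.pi) < 0 := mul_neg_of_pos_of_neg ht.1 hθ'
    have h2 : θ - 2 * Real.pi ≤ t * (θ - 2 * Real.pi) := by nlinarith [ht.2]
    have h3 : 0 < s * θ := mul_pos hs.1 hθ0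
    have h4 : s * θ < θ := by nlinarith
    have hm0 : (m : ℝ) < 0 := by
      by_contra h
      nlinarith
    have hm1 : (-1 : ℝ) < m := by
      by_contra h
      nlinarith
    have hm0' : m < 0 := by exact_mod_cast hm0
    have hm1' : -1 < m := by exact_mod_cast hm1
    omega

/-- The curve `s ↦ ρ s * z * exp (i s θ)` is injective if `ρ > 0` and `0 < |θ| < 2π`. -/
lemma injOn_mul_exp {z : ℂ} (hz : ‖z‖ = 1) {θ : ℝ} (hθ0 : θ ≠ 0) (hθ : |θ| < 2 * Real.pi)
    {ρ : ℝ → ℝ} (hρ : ∀ s, 0 < ρ s) :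
    InjOn (fun s : ℝ => (ρ s : ℂ) * (z * Complex.exp ((s * θ : ℝ) * Complex.I))) (Icc 0 1) := by
  have hz0 : z ≠ 0 := norm_ne_zero_iff.1 (by rw [hz]; exact one_ne_zero)
  intro s hs t ht hst
  simp only at hst
  have hn := congrArg norm hst
  simp only [norm_mul, Complex.norm_real, Complex.norm_exp_ofReal_mul_I, hz, mul_one,
    Real.norm_eq_abs, abs_of_pos (hρ _)] at hn
  rw [hn] at hst
  have hρt : (ρ t : ℂ) ≠ 0 := by exact_mod_cast (hρ t).ne'
  obtain ⟨m, hm⟩ := Complex.exp_eq_exp_iff_exists_int.1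
    (mul_left_cancel₀ hz0 (mul_left_cancel₀ hρt hst))
  have hm' : s * θ = t * θ + m * (2 * Real.pi) := by
    have hI : ((s * θ : ℝ) : ℂ) * Complex.I =
        ((t * θ + m * (2 * Real.pi) : ℝ) : ℂ) * Complex.I := by
      rw [hm]
      push_cast
      ring
    exact_mod_cast mul_right_cancel₀ Complex.I_ne_zero hI
  have habs : |(m : ℝ)| * (2 * Real.pi) < 1 * (2 * Real.pi) := by
    have h1 : (m : ℝ) * (2 * Real.pi) = (s - t) * θ := by linarith
    have h2 : |s - t| ≤ 1 := abs_le.2 ⟨by linarith [hs.1, ht.2], by linarith [hs.2, ht.1]⟩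
    have h3 : |(m : ℝ)| * (2 * Real.pi) = |s - t| * |θ| := by
      rw [← abs_mul, ← h1, abs_mul, abs_of_pos Real.two_pi_pos]
    rw [h3]
    nlinarith [abs_nonneg θ]
  have hm1 : |(m : ℝ)| < 1 := lt_of_mul_lt_mul_right habs Real.two_pi_pos.le
  have hm0 : m = 0 := by
    rw [← Int.abs_lt_one_iff]
    exact_mod_cast hm1
  rw [hm0] at hm'
  refine mul_right_cancel₀ hθ0 (hm'.trans ?_)
  simp

/-- The endpoint `z` on the unit circle of a closed set `K` meeting the circle only in `z` and `z'`
can be reached along an arc from any side `U` of `K` which touches the circle elsewhere. -/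
lemma exists_arc_to_endpoint {K U V : Set ℂ} (hK : IsClosed K) (hU : IsOpen U)
    (hV : IsOpen V) (hdis : Disjoint U V) (hUV : ball (0 : ℂ) 1 \ K = U ∪ V) {z z' w : ℂ}
    (hz : ‖z‖ = 1) (hzK : z ∈ K) (hz'K : z' ∈ K) (hKs : ∀ x ∈ K, ‖x‖ = 1 → x = z ∨ x = z')
    (hw : ‖w‖ = 1) (hwK : w ∉ K) (hwU : w ∈ closure U) :
    ∃ σ : ℝ → ℂ, ContinuousOn σ (Icc 0 1) ∧ InjOn σ (Icc 0 1) ∧ σ 0 = z ∧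
      MapsTo σ (Ioc 0 1) U := by
  obtain ⟨θ, hθ0, hθ, hwθ, hav⟩ := exists_arc_avoiding hz hw (z' := z')
    (fun h => hwK (h ▸ hzK)) (fun h => hwK (h ▸ hz'K))
  let e : ℝ → ℂ := fun s => z * Complex.exp ((s * θ : ℝ) * Complex.I)
  have hec : Continuous e := by fun_prop
  have he1 : ∀ s, ‖e s‖ = 1 := fun s => by
    simp only [e, norm_mul, hz, Complex.norm_exp_ofReal_mul_I, mul_one]
  have he0 : e 0 = z := by simp [e]
  have hew : e 1 = w := by simp only [e, one_mul]; exact hwθ.symm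
  let d : ℝ → ℝ := fun s => min 1 (infDist (e s) K)
  have hdc : Continuous d := continuous_const.min ((continuous_infDist_pt K).comp hec)
  have hd0 : ∀ s, 0 ≤ d s := fun s => le_min zero_le_one infDist_nonneg
  have hd1 : ∀ s, d s ≤ 1 := fun s => min_le_left _ _
  have hez : ∀ s ∈ Ioc (0 : ℝ) 1, e s ≠ z := by
    intro s hs h
    have hinj := injOn_mul_exp hz hθ0 hθ (ρ := fun _ => 1) (fun _ => one_pos)
    refine hs.1.ne' (hinj ⟨hs.1.le, hs.2⟩ ⟨le_rfl, zero_le_one⟩ ?_)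
    change (1 : ℝ) * e s = (1 : ℝ) * e 0
    rw [h, he0]
  have heK : ∀ s ∈ Ioc (0 : ℝ) 1, e s ∉ K := fun s hs h =>
    (hKs _ h (he1 s)).elim (hez s hs) (hav s hs)
  have hdpos : ∀ s ∈ Ioc (0 : ℝ) 1, 0 < d s := fun s hs =>
    lt_min one_pos ((hK.notMem_iff_infDist_pos ⟨z, hzK⟩).1 (heK s hs))
  have hballK : ∀ s, Disjoint (ball (e s) (d s)) K := fun s =>
    disjoint_ball_infDist.mono_left (ball_subset_ball (min_le_right _ _))
  let σ : ℝ → ℂ := fun s => ((1 - d s / 2 : ℝ) : ℂ) * e s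
  have hσc : Continuous σ := by fun_prop
  have hσball : ∀ s ∈ Ioc (0 : ℝ) 1, σ s ∈ ball (e s) (d s) ∩ ball 0 1 := by
    intro s hs
    have hp := hdpos s hs
    constructor
    · rw [mem_ball, dist_eq_norm]
      have : σ s - e s = ((-(d s / 2) : ℝ) : ℂ) * e s := by
        simp only [σ]
        push_cast
        ring
      rw [this, norm_mul, he1, Complex.norm_real, norm_neg, Real.norm_eq_abs,
        abs_of_pos (half_pos hp)]
      linarith
    · rw [mem_ball_zero_iff]
      simp only [σ]
      rw [norm_mul, he1, Complex.norm_real, Real.norm_eq_abs, abs_of_pos (by linarith [hd1 s])]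
      linarith
  refine ⟨σ, hσc.continuousOn, injOn_mul_exp hz hθ0 hθ fun s => by linarith [hd1 s], ?_, ?_⟩
  · have : d 0 = 0 := by
      simp only [d, he0, infDist_zero_of_mem hzK]
      exact min_eq_right zero_le_one
    simp [σ, this, he0]
  · have hpre : IsPreconnected (σ '' Ioc 0 1) := isPreconnected_Ioc.image _ hσc.continuousOn
    have hsub : σ '' Ioc 0 1 ⊆ U := by
      refine hpre.subset_left_of_subset_union hU hV hdis ?_ ?_
      · rintro _ ⟨s, hs, rfl⟩
        rw [← hUV]
        exact ⟨(hσball s hs).2, (hballK s).notMem_of_mem_left (hσball s hs).1⟩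
      · have h1 : (1 : ℝ) ∈ Ioc (0 : ℝ) 1 := ⟨one_pos, le_rfl⟩
        exact ⟨σ 1, ⟨1, h1, rfl⟩, ball_inter_ball_subset_left hU hV hdis hUV (hdpos 1 h1)
          (hballK 1) (hew ▸ hwU) (hσball 1 h1)⟩
    exact mapsTo_iff_image_subset.2 hsub

/-- Let `δ` be a curve in the disk whose image under a univalent function `Ψ`, continuous on the
closed disk, tends to a point outside `Ψ(D)`. Then `δ` itself converges to a point of the
circle. -/
lemma exists_tendsto_of_tendsto_comp {Ψ : ℂ → ℂ} (hΨ : DiffContOnCl ℂ Ψ (ball 0 1))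
    (hinj : InjOn Ψ (ball 0 1)) {δ : ℝ → ℂ} (hδ : ContinuousOn δ (Ioo 0 1))
    (hδb : MapsTo δ (Ioo 0 1) (ball 0 1)) {c : ℂ} (hlim : Tendsto (Ψ ∘ δ) (𝓝[>] 0) (𝓝 c))
    (hc : c ∉ Ψ '' ball 0 1) :
    ∃ z, ‖z‖ = 1 ∧ Ψ z = c ∧ Tendsto δ (𝓝[>] 0) (𝓝 z) := by
  have hI : Ioo (0 : ℝ) 1 ∈ 𝓝[>] (0 : ℝ) := Ioo_mem_nhdsGT one_pos
  have hδc : MapsTo δ (Ioo 0 1) (closedBall 0 1) := hδb.mono_right ball_subset_closedBall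
  have hcont : ContinuousOn Ψ (closedBall 0 1) := hΨ.continuousOn_ball
  have hev : ∀ᶠ t in 𝓝[>] (0 : ℝ), δ t ∈ closedBall (0 : ℂ) 1 := mem_of_superset hI hδc
  have hcomp : IsCompact (closedBall (0 : ℂ) 1) := isCompact_closedBall 0 1
  have hprop : ∀ x, MapClusterPt x (𝓝[>] (0 : ℝ)) δ → ‖x‖ = 1 ∧ Ψ x = c := by
    intro x hx
    obtain ⟨u, hu, hux⟩ := mapClusterPt_iff_ultrafilter.1 hx
    have hevu : ∀ᶠ t in (u : Filter ℝ), δ t ∈ closedBall (0 : ℂ) 1 := hu hev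
    have hxb : x ∈ closedBall (0 : ℂ) 1 := isClosed_closedBall.mem_of_tendsto hux hevu
    have h1 : Tendsto (Ψ ∘ δ) u (𝓝 (Ψ x)) :=
      (hcont x hxb).tendsto.comp (tendsto_nhdsWithin_iff.2 ⟨hux, hevu⟩)
    have hxc : Ψ x = c := tendsto_nhds_unique h1 (hlim.mono_left hu)
    refine ⟨le_antisymm (mem_closedBall_zero_iff.1 hxb) (not_lt.1 fun h => hc ?_), hxc⟩
    exact ⟨x, mem_ball_zero_iff.2 h, hxc⟩
  have hsing := subsingleton_of_isPreconnected_of_eq hΨ hinj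
    (isPreconnected_setOf_mapClusterPt hcomp hδ hδc)
    (fun x hx => mem_sphere_zero_iff_norm.2 (hprop x hx).1) (c := c) fun x hx => (hprop x hx).2
  obtain ⟨z, -, hz⟩ := hcomp.exists_mapClusterPt_of_frequently hev.frequently
  exact ⟨z, (hprop z hz).1, (hprop z hz).2,
    hcomp.tendsto_nhds_of_unique_mapClusterPt hev fun x _ hx => hsing hx hz⟩

/-- Let `δ` be an arc joining two points of the unit circle through the open disk, and let the
complement of `δ` in the disk be the union of two disjoint open sets `U` and `V`. Then each point
of the circle in the closure of `U` is accessible from `U`. -/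
lemma exists_arc_of_mem_closure {δ : ℝ → ℂ} (hc : ContinuousOn δ (Icc 0 1))
    (hi : InjOn δ (Icc 0 1)) (hδb : MapsTo δ (Ioo 0 1) (ball 0 1)) {U V : Set ℂ}
    (hU : IsOpen U) (hV : IsOpen V) (hdis : Disjoint U V)
    (hUV : ball (0 : ℂ) 1 \ δ '' Icc 0 1 = U ∪ V) {z : ℂ} (hz : ‖z‖ = 1) (hzU : z ∈ closure U) :
    ∃ σ : ℝ → ℂ, ContinuousOn σ (Icc 0 1) ∧ InjOn σ (Icc 0 1) ∧ σ 0 = z ∧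
      MapsTo σ (Ioc 0 1) U := by
  have hz0 : z ≠ 0 := norm_ne_zero_iff.1 (by rw [hz]; exact one_ne_zero)
  have hKcl : IsClosed (δ '' Icc 0 1) := (isCompact_Icc.image_of_continuousOn hc).isClosed
  have hUsub : U ⊆ ball (0 : ℂ) 1 \ δ '' Icc 0 1 := hUV ▸ subset_union_left
  have hmem0 : δ 0 ∈ δ '' Icc 0 1 := ⟨0, by simp, rfl⟩
  have hmem1 : δ 1 ∈ δ '' Icc 0 1 := ⟨1, by simp, rfl⟩
  have hKs : ∀ x ∈ δ '' Icc 0 1, ‖x‖ = 1 → x = δ 0 ∨ x = δ 1 := by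
    rintro _ ⟨t, ht, rfl⟩ hx
    rcases eq_or_lt_of_le ht.1 with h | h
    · exact Or.inl (by rw [← h])
    rcases eq_or_lt_of_le ht.2 with h' | h'
    · exact Or.inr (by rw [h'])
    have := mem_ball_zero_iff.1 (hδb ⟨h, h'⟩)
    exact absurd hx this.ne
  by_cases hzK : z ∈ δ '' Icc 0 1
  · obtain ⟨w, hwf, hwK⟩ := not_subset.1 (not_frontier_subset_arc hc hi
      (isBounded_ball.subset (hUsub.trans sdiff_subset)) (closure_nonempty_iff.1 ⟨z, hzU⟩)
      (disjoint_sdiff_left.mono_left hUsub))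
    have hwU : w ∈ closure U := frontier_subset_closure hwf
    have hwn : w ∉ U := by
      rw [hU.frontier_eq] at hwf
      exact hwf.2
    have hw1 : ‖w‖ ≤ 1 := by
      have := closure_mono (hUsub.trans (sdiff_subset.trans ball_subset_closedBall)) hwU
      rwa [isClosed_closedBall.closure_eq, mem_closedBall_zero_iff] at this
    have hw : ‖w‖ = 1 := by
      refine le_antisymm hw1 (not_lt.1 fun h => ?_)
      have : w ∈ U ∪ V := hUV ▸ ⟨mem_ball_zero_iff.2 h, hwK⟩
      have hwV : w ∈ V := this.resolve_left hwn
      exact (hdis.closure_left hV).le_bot ⟨hwU, hwV⟩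
    rcases hKs z hzK hz with rfl | rfl
    · exact exists_arc_to_endpoint hKcl hU hV hdis hUV hz hmem0 hmem1 hKs hw hwK hwU
    · exact exists_arc_to_endpoint hKcl hU hV hdis hUV hz hmem1 hmem0
        (fun x hx h => (hKs x hx h).symm) hw hwK hwU
  · have hr := (hKcl.notMem_iff_infDist_pos ⟨_, hmem0⟩).1 hzK
    have hsub := ball_inter_ball_subset_left hU hV hdis hUV hr disjoint_ball_infDist hzU
    set r := infDist z (δ '' Icc 0 1)
    obtain ⟨ρ, hρ0, hρ⟩ := exists_between (lt_min one_pos hr)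
    obtain ⟨hρ1, hρr⟩ := lt_min_iff.1 hρ
    refine ⟨fun s => ((1 - ρ * s : ℝ) : ℂ) * z, by fun_prop, ?_, by simp, ?_⟩
    · intro s _ t _ hst
      have h1 : (1 - ρ * s : ℝ) = 1 - ρ * t := by exact_mod_cast mul_right_cancel₀ hz0 hst
      exact mul_left_cancel₀ hρ0.ne' (by linarith)
    · intro s hs
      have h1 : 0 < ρ * s := mul_pos hρ0 hs.1
      have h2 : ρ * s ≤ ρ := mul_le_of_le_one_right hρ0.le hs.2
      refine hsub ⟨?_, ?_⟩
      · rw [mem_ball, dist_eq_norm]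
        have : ((1 - ρ * s : ℝ) : ℂ) * z - z = ((-(ρ * s) : ℝ) : ℂ) * z := by
          push_cast
          ring
        rw [this, norm_mul, hz, Complex.norm_real, norm_neg, Real.norm_eq_abs, abs_of_pos h1]
        linarith
      · rw [mem_ball_zero_iff, norm_mul, hz, Complex.norm_real, Real.norm_eq_abs,
          abs_of_pos (by linarith)]
        linarith

/-- The inverse of an injective holomorphic function on the disk is continuous. -/
lemma continuousOn_invFunOn_ball {Ψ : ℂ → ℂ} (hd : DifferentiableOn ℂ Ψ (ball 0 1))
    (hinj : InjOn Ψ (ball 0 1)) :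
    ContinuousOn (Function.invFunOn Ψ (ball 0 1)) (Ψ '' ball 0 1) := by
  have hopen : ∀ s ⊆ ball (0 : ℂ) 1, IsOpen s → IsOpen (Ψ '' s) := by
    refine ((hd.analyticOnNhd isOpen_ball).is_constant_or_isOpen
      (convex_ball 0 1).isPreconnected).resolve_left ?_
    rintro ⟨w, hw⟩
    have h0 : (0 : ℂ) ∈ ball (0 : ℂ) 1 := by simp
    have h1 : (1 / 2 : ℂ) ∈ ball (0 : ℂ) 1 := by
      rw [mem_ball_zero_iff]
      norm_num
    have := hinj h0 h1 ((hw _ h0).trans (hw _ h1).symm)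
    norm_num at this
  refine _root_.continuousOn_iff'.2 fun t ht => ?_
  refine ⟨Ψ '' (t ∩ ball 0 1), hopen _ inter_subset_right (ht.inter isOpen_ball), ?_⟩
  ext y
  constructor
  · rintro ⟨hy, x, hx, rfl⟩
    rw [mem_preimage, hinj.leftInvOn_invFunOn hx] at hy
    exact ⟨⟨x, ⟨hy, hx⟩, rfl⟩, x, hx, rfl⟩
  · rintro ⟨⟨x, ⟨hxt, hx⟩, rfl⟩, h⟩
    refine ⟨?_, h⟩
    rw [mem_preimage, hinj.leftInvOn_invFunOn hx]
    exact hxt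

/-- A crosscut of `Ψ(D)` lifts to an arc in the closed disk with endpoints on the circle. -/
lemma exists_lift_crosscut {Ψ : ℂ → ℂ} (hΨ : DiffContOnCl ℂ Ψ (ball 0 1))
    (hinj : InjOn Ψ (ball 0 1)) {γ : ℝ → ℂ} (hγ : ContinuousOn γ (Icc 0 1))
    (hγi : InjOn γ (Icc 0 1)) (hγG : MapsTo γ (Ioo 0 1) (Ψ '' ball 0 1))
    (h0 : γ 0 ∉ Ψ '' ball 0 1) (h1 : γ 1 ∉ Ψ '' ball 0 1) :
    ∃ δ : ℝ → ℂ, ContinuousOn δ (Icc 0 1) ∧ InjOn δ (Icc 0 1) ∧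
      MapsTo δ (Ioo 0 1) (ball 0 1) ∧ ‖δ 0‖ = 1 ∧ ‖δ 1‖ = 1 ∧ EqOn (Ψ ∘ δ) γ (Icc 0 1) := by
  let η : ℝ → ℂ := Function.invFunOn Ψ (ball 0 1) ∘ γ
  have hη : ContinuousOn η (Ioo 0 1) :=
    (continuousOn_invFunOn_ball hΨ.differentiableOn hinj).comp (hγ.mono Ioo_subset_Icc_self) hγG
  have hηb : MapsTo η (Ioo 0 1) (ball 0 1) := fun t ht => Function.invFunOn_mem (hγG ht)
  have hΨη : ∀ t ∈ Ioo (0 : ℝ) 1, Ψ (η t) = γ t := fun t ht => Function.invFunOn_eq (hγG ht)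
  have hl0 : Tendsto γ (𝓝[>] 0) (𝓝 (γ 0)) := by
    have := (hγ 0 (by simp)).mono_left (nhdsWithin_mono _ (Ioo_subset_Icc_self (a := (0 : ℝ))))
    rwa [nhdsWithin_Ioo_eq_nhdsGT one_pos] at this
  have hl1 : Tendsto γ (𝓝[<] 1) (𝓝 (γ 1)) := by
    have := (hγ 1 (by simp)).mono_left (nhdsWithin_mono _ (Ioo_subset_Icc_self (a := (0 : ℝ))))
    rwa [nhdsWithin_Ioo_eq_nhdsLT one_pos] at this
  have hflip : MapsTo (fun t : ℝ => 1 - t) (Ioo 0 1) (Ioo 0 1) := fun t ht =>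
    ⟨by linarith [ht.2], by linarith [ht.1]⟩
  have hflipR : Tendsto (fun t : ℝ => 1 - t) (𝓝[>] 0) (𝓝[<] 1) := by
    refine tendsto_nhdsWithin_iff.2 ⟨?_, ?_⟩
    · exact ((continuous_const.sub continuous_id).tendsto' 0 1 (by simp)).mono_left
        nhdsWithin_le_nhds
    · filter_upwards [self_mem_nhdsWithin] with t ht
      exact mem_Iio.2 (sub_lt_self 1 (mem_Ioi.1 ht))
  have hflipL : Tendsto (fun t : ℝ => 1 - t) (𝓝[<] 1) (𝓝[>] 0) := by
    refine tendsto_nhdsWithin_iff.2 ⟨?_, ?_⟩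
    · exact ((continuous_const.sub continuous_id).tendsto' 1 0 (by simp)).mono_left
        nhdsWithin_le_nhds
    · filter_upwards [self_mem_nhdsWithin] with t ht
      exact mem_Ioi.2 (sub_pos.2 (mem_Iio.1 ht))
  obtain ⟨z₀, hz₀, hΨz₀, ht₀⟩ := exists_tendsto_of_tendsto_comp hΨ hinj hη hηb
    (hl0.congr' (eventually_of_mem (Ioo_mem_nhdsGT one_pos) fun t ht => (hΨη t ht).symm)) h0
  obtain ⟨z₁, hz₁, hΨz₁, ht₁⟩ := exists_tendsto_of_tendsto_comp hΨ hinj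
    (δ := η ∘ fun t => 1 - t) (hη.comp (by fun_prop) hflip) (hηb.comp hflip)
    ((hl1.comp hflipR).congr' (eventually_of_mem (Ioo_mem_nhdsGT one_pos)
      fun t ht => (hΨη _ (hflip ht)).symm)) h1
  have ht₁' : Tendsto η (𝓝[<] 1) (𝓝 z₁) :=
    (ht₁.comp hflipL).congr fun t => by simp
  have hcont := continuousOn_Icc_extendFrom_Ioo hη ht₀ ht₁'
  have hδ0 := eq_lim_at_left_extendFrom_Ioo one_pos ht₀
  have hδ1 := eq_lim_at_right_extendFrom_Ioo one_pos ht₁'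
  have hδ : ∀ t ∈ Ioo (0 : ℝ) 1, extendFrom (Ioo 0 1) η t = η t := fun t ht =>
    extendFrom_extends hη t ht
  set δ := extendFrom (Ioo 0 1) η
  have hΨδ : EqOn (Ψ ∘ δ) γ (Icc 0 1) := by
    intro t ht
    rcases eq_or_lt_of_le ht.1 with h | h
    · rw [← h, Function.comp_apply, hδ0, hΨz₀]
    rcases eq_or_lt_of_le ht.2 with h' | h'
    · rw [h', Function.comp_apply, hδ1, hΨz₁]
    rw [Function.comp_apply, hδ t ⟨h, h'⟩, hΨη t ⟨h, h'⟩]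
  refine ⟨δ, hcont, ?_, fun t ht => hδ t ht ▸ hηb ht, hδ0 ▸ hz₀, hδ1 ▸ hz₁, hΨδ⟩
  intro s hs t ht hst
  refine hγi hs ht ?_
  rw [← hΨδ hs, ← hΨδ ht, Function.comp_apply, Function.comp_apply, hst]

/-- A boundary point of `Ψ(D)` in the closure of a side `U` of a crosscut is accessible
from `U`. -/
lemma mem_accessiblePts_of_crosscut {Ψ : ℂ → ℂ} (hΨ : DiffContOnCl ℂ Ψ (ball 0 1))
    (hinj : InjOn Ψ (ball 0 1)) {J : Set ℂ} (hJ : IsCrosscut (Ψ '' ball 0 1) J)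
    (hGo : IsOpen (Ψ '' ball 0 1)) {U V : Set ℂ} (hU : IsOpen U) (hV : IsOpen V)
    (hdis : Disjoint U V) (hUV : Ψ '' ball 0 1 \ J = U ∪ V) {a : ℂ}
    (haG : a ∈ frontier (Ψ '' ball 0 1)) (haU : a ∈ frontier U) : a ∈ accessiblePts U := by
  obtain ⟨γ, hγ, hγi, rfl, hJG, h0, h1⟩ := hJ
  rw [hGo.frontier_eq] at haG h0 h1
  obtain ⟨δ, hδ, hδi, hδb, hδ0, hδ1, hΨδ⟩ := exists_lift_crosscut hΨ hinj hγ hγi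
    (mapsTo_iff_image_subset.2 hJG) h0.2 h1.2
  have hcl : ContinuousOn Ψ (closedBall 0 1) := hΨ.continuousOn_ball
  have hcb : ContinuousOn Ψ (ball 0 1) := hΨ.differentiableOn.continuousOn
  have hpre : ball (0 : ℂ) 1 \ δ '' Icc 0 1 = (ball 0 1 ∩ Ψ ⁻¹' U) ∪ (ball 0 1 ∩ Ψ ⁻¹' V) := by
    rw [← inter_union_distrib_left, ← preimage_union, ← hUV]
    ext x
    constructor
    · rintro ⟨hx, hxK⟩
      refine ⟨hx, ⟨x, hx, rfl⟩, ?_⟩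
      rintro ⟨t, ht, htx⟩
      have htI := Ioo_subset_Icc_self ht
      exact hxK ⟨t, htI, hinj (hδb ht) hx ((hΨδ htI).trans htx)⟩
    · rintro ⟨hx, -, hxJ⟩
      refine ⟨hx, ?_⟩
      rintro ⟨t, ht, rfl⟩
      rw [mem_ball_zero_iff] at hx
      refine hxJ ⟨t, ⟨lt_of_le_of_ne ht.1 ?_, lt_of_le_of_ne ht.2 ?_⟩, (hΨδ ht).symm⟩
      · rintro rfl
        exact hx.ne hδ0
      · rintro rfl
        exact hx.ne hδ1
  have hU'c : closure (ball 0 1 ∩ Ψ ⁻¹' U) ⊆ closedBall (0 : ℂ) 1 :=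
    closure_minimal (inter_subset_left.trans ball_subset_closedBall) isClosed_closedBall
  have hcomp : IsCompact (Ψ '' closure (ball 0 1 ∩ Ψ ⁻¹' U)) :=
    ((isCompact_closedBall 0 1).of_isClosed_subset isClosed_closure hU'c).image_of_continuousOn
      (hcl.mono hU'c)
  have hUim : U ⊆ Ψ '' closure (ball 0 1 ∩ Ψ ⁻¹' U) := by
    intro y hy
    obtain ⟨x, hx, rfl⟩ : y ∈ Ψ '' ball 0 1 :=
      (hUV ▸ Or.inl hy : y ∈ Ψ '' ball 0 1 \ γ '' Ioo 0 1).1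
    exact ⟨x, subset_closure ⟨hx, hy⟩, rfl⟩
  obtain ⟨z, hz, rfl⟩ := closure_minimal hUim hcomp.isClosed (frontier_subset_closure haU)
  have hz1 : ‖z‖ = 1 := by
    refine le_antisymm (mem_closedBall_zero_iff.1 (hU'c hz)) (not_lt.1 fun h => haG.2 ?_)
    exact ⟨z, mem_ball_zero_iff.2 h, rfl⟩
  obtain ⟨σ, hσ, hσi, rfl, hσU⟩ := exists_arc_of_mem_closure hδ hδi hδb
    (hcb.isOpen_inter_preimage isOpen_ball hU) (hcb.isOpen_inter_preimage isOpen_ball hV)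
    ((hdis.preimage Ψ).mono inter_subset_right inter_subset_right) hpre hz1 hz
  have hσb : MapsTo σ (Icc 0 1) (closedBall 0 1) := by
    intro s hs
    rcases eq_or_lt_of_le hs.1 with h | h
    · rw [← h, mem_closedBall_zero_iff, hz1]
    · exact ball_subset_closedBall (hσU ⟨h, hs.2⟩).1
  have hflip : MapsTo (fun t : ℝ => 1 - t) (Icc 0 1) (Icc 0 1) := fun t ht =>
    ⟨by linarith [ht.2], by linarith [ht.1]⟩
  have hΨσi : InjOn (Ψ ∘ σ) (Icc 0 1) := by
    have hmem : ∀ t ∈ Ioc (0 : ℝ) 1, Ψ (σ t) ≠ Ψ (σ 0) := fun t ht h =>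
      haG.2 (h ▸ ⟨σ t, (hσU ht).1, rfl⟩)
    intro s hs t ht hst
    rcases eq_or_lt_of_le hs.1 with h | h <;> rcases eq_or_lt_of_le ht.1 with h' | h'
    · rw [← h, ← h']
    · subst h
      exact absurd hst.symm (hmem t ⟨h', ht.2⟩)
    · subst h'
      exact absurd hst (hmem s ⟨h, hs.2⟩)
    · exact hσi hs ht (hinj (hσU ⟨h, hs.2⟩).1 (hσU ⟨h', ht.2⟩).1 hst)
  refine ⟨haU, fun t => Ψ (σ (1 - t)), ?_, ?_, ?_, by simp⟩
  · exact (hcl.comp hσ hσb).comp (by fun_prop) hflip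
  · intro s hs t ht hst
    have := hΨσi (hflip hs) (hflip ht) hst
    linarith
  · rintro _ ⟨t, ht, rfl⟩
    exact (hσU ⟨by linarith [ht.2], by linarith [ht.1]⟩).2

theorem no_semiUnreachable_of_psi_extends
    (G : Set ℂ) (hGopen : IsOpen G) (hGconn : IsConnected G)
    (hGsc : SimplyConnectedSpace ↥G) (hGbd : (frontier G).Nontrivial)
    (ψ : ℂ → ℂ) (hψd : DifferentiableOn ℂ ψ (Metric.ball (0 : ℂ) 1))
    (hψi : Set.InjOn ψ (Metric.ball (0 : ℂ) 1))
    (hψs : ψ '' Metric.ball (0 : ℂ) 1 = G)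
    (hext : ExtendsContinuously ψ) :
    semiUnreachablePts G = ∅ := by
  obtain ⟨Ψ, hΨc, hΨψ⟩ := hext
  have hΨ : DiffContOnCl ℂ Ψ (ball 0 1) :=
    ⟨hψd.congr hΨψ, by rwa [closure_ball 0 one_ne_zero]⟩
  have hinj : InjOn Ψ (ball 0 1) := hΨψ.injOn_iff.2 hψi
  have himg : Ψ '' ball 0 1 = G := hΨψ.image_eq.trans hψs
  subst himg
  refine eq_empty_iff_forall_notMem.2 ?_
  rintro a ⟨haG, J, U, V, hJ, hU, hV, -, -, hdis, hUV, ⟨haU, haU'⟩ | ⟨haV, haV'⟩, -⟩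
  · exact haU' (mem_accessiblePts_of_crosscut hΨ hinj hJ hGopen hU hV hdis hUV haG haU)
  · exact haV' (mem_accessiblePts_of_crosscut hΨ hinj hJ hGopen hV hU hdis.symm
      (hUV.trans (union_comm U V)) haG haV)
end

section
/- Let G ⊆ ℂ be a Jordan domain and let ψ be a univalent analytic map from the open unit disk D onto G. Then ψ extends to a homeomorphism from the closed unit disk onto the closure of G; equivalently, the Riemann map φ = ψ⁻¹ : G → D extends to a homeomorphism from the closure of G onto the closed unit disk. -/
/-- `Γ` is a Jordan curve: the image of an injective continuous map
from the unit circle into `ℂ`. -/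
def IsJordanCurve (Γ : Set ℂ) : Prop :=
  ∃ f : ℂ → ℂ, ContinuousOn f (Metric.sphere (0 : ℂ) 1) ∧
    Set.InjOn f (Metric.sphere (0 : ℂ) 1) ∧ Γ = f '' Metric.sphere (0 : ℂ) 1

/-- `G` is a Jordan domain: a bounded nonempty open connected set that is a
connected component of the complement of a Jordan curve `Γ` with `∂G = Γ`. -/
def IsJordanDomain (G : Set ℂ) : Prop :=
  IsOpen G ∧ IsConnected G ∧ Bornology.IsBounded G ∧
    ∃ Γ : Set ℂ, IsJordanCurve Γ ∧ frontier G = Γ ∧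
      ∃ z ∈ G, G = connectedComponentIn Γᶜ z

section

open Set Metric Topology Filter MeasureTheory
open scoped ENNReal

theorem IsPreconnected.sub_eq_sub_of_exp_eq_exp {X : Type*} [TopologicalSpace X] {U : Set X}
    (hU : IsPreconnected U) {f g : X → ℂ} (hf : ContinuousOn f U) (hg : ContinuousOn g U)
    (h : ∀ x ∈ U, Complex.exp (f x) = Complex.exp (g x)) {x y : X} (hx : x ∈ U) (hy : y ∈ U) :
    f x - g x = f y - g y := by
  have key : ∀ x ∈ U, ∃ n : ℤ, f x - g x = n * (2 * Real.pi * Complex.I) := fun x hx ↦ by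
    obtain ⟨n, hn⟩ := Complex.exp_eq_exp_iff_exists_int.1 (h x hx)
    exact ⟨n, by rw [hn]; ring⟩
  have hT : IsDiscrete (range ((↑) : ℤ → ℝ)) :=
    ⟨Int.isClosedEmbedding_coe_real.isEmbedding.toHomeomorph.symm.isEmbedding.discreteTopology⟩
  have h2 : (2 * Real.pi * Complex.I : ℂ) ≠ 0 := Complex.two_pi_I_ne_zero
  have := hU.constant_of_mapsTo hT
    (f := fun x ↦ ((f x - g x) / (2 * Real.pi * Complex.I)).re)
    (Complex.continuous_re.comp_continuousOn ((hf.sub hg).div_const _))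
    (fun x hx ↦ by
      obtain ⟨n, hn⟩ := key x hx
      exact ⟨n, by simp only [hn]; rw [mul_div_cancel_right₀ _ h2]; simp⟩) hx hy
  obtain ⟨n, hn⟩ := key x hx
  obtain ⟨m, hm⟩ := key y hy
  simp only [hn, hm] at this ⊢
  rw [mul_div_cancel_right₀ _ h2, mul_div_cancel_right₀ _ h2] at this
  simp at this
  rw [this]

/-- The quotient `(z - a) / (z - b)` has a continuous logarithm on `K`. -/
def HasContinuousLogQuotient (K : Set ℂ) (a b : ℂ) : Prop :=
  ∃ L : ℂ → ℂ, ContinuousOn L K ∧ ∀ z ∈ K, Complex.exp (L z) = (z - a) / (z - b)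

namespace HasContinuousLogQuotient

variable {K A B : Set ℂ} {a b c : ℂ}

theorem mono (h : HasContinuousLogQuotient B a b) (hAB : A ⊆ B) :
    HasContinuousLogQuotient A a b :=
  let ⟨L, hL, h⟩ := h
  ⟨L, hL.mono hAB, fun z hz ↦ h z (hAB hz)⟩

theorem symm (h : HasContinuousLogQuotient K a b) : HasContinuousLogQuotient K b a := by
  obtain ⟨L, hL, h⟩ := h
  exact ⟨fun z ↦ -L z, hL.neg, fun z hz ↦ by rw [Complex.exp_neg, h z hz, inv_div]⟩

theorem trans (hb : b ∉ K) (hab : HasContinuousLogQuotient K a b)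
    (hbc : HasContinuousLogQuotient K b c) : HasContinuousLogQuotient K a c := by
  obtain ⟨L, hL, h⟩ := hab
  obtain ⟨M, hM, h'⟩ := hbc
  refine ⟨fun z ↦ L z + M z, hL.add hM, fun z hz ↦ ?_⟩
  have : z - b ≠ 0 := sub_ne_zero.2 fun h ↦ hb (h ▸ hz)
  rw [Complex.exp_add, h z hz, h' z hz, div_mul_div_cancel₀ this]

theorem of_forall_dist_lt (h : ∀ z ∈ K, dist a b < dist z b) :
    HasContinuousLogQuotient K a b := by
  have hb : ∀ z ∈ K, z - b ≠ 0 := fun z hz ↦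
    norm_pos_iff.1 (by rw [← dist_eq_norm]; exact dist_nonneg.trans_lt (h z hz))
  have hs : ∀ z ∈ K, (z - a) / (z - b) ∈ Complex.slitPlane := fun z hz ↦ by
    have : (z - a) / (z - b) = 1 + (b - a) / (z - b) := by
      field_simp [hb z hz]; ring
    rw [this]
    apply Complex.mem_slitPlane_of_norm_lt_one
    rw [norm_div, div_lt_one (norm_pos_iff.2 (hb z hz)), ← dist_eq_norm, ← dist_eq_norm,
      dist_comm b a]
    exact h z hz
  refine ⟨fun z ↦ Complex.log ((z - a) / (z - b)), ContinuousOn.clog ?_ hs, fun z hz ↦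
    Complex.exp_log (Complex.slitPlane_ne_zero (hs z hz))⟩
  exact ContinuousOn.div (by fun_prop) (by fun_prop) hb

theorem of_isPreconnected (hK : IsClosed K) {S : Set ℂ} (hS : IsPreconnected S)
    (hSK : Disjoint S K) (ha : a ∈ S) (hb : b ∈ S) : HasContinuousLogQuotient K a b := by
  refine hS.induction₂ (HasContinuousLogQuotient K) (fun x hx ↦ ?_)
    (fun x y z _ hy _ h h' ↦ trans (disjoint_left.1 hSK hy) h h') (fun _ _ _ _ h ↦ h.symm) ha hb
  obtain ⟨r, hr, hrK⟩ := Metric.isOpen_iff.1 hK.isOpen_compl x (disjoint_left.1 hSK hx)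
  filter_upwards [mem_nhdsWithin_of_mem_nhds (Metric.ball_mem_nhds x hr)] with y hy
  refine (of_forall_dist_lt fun z hz ↦ ?_).symm
  have : z ∉ ball x r := fun h ↦ hrK h hz
  rw [mem_ball, not_lt] at this
  exact lt_of_lt_of_le hy this

theorem union (hA : IsClosed A) (hB : IsClosed B) (hAB : IsPreconnected (A ∩ B))
    (h : HasContinuousLogQuotient A a b) (h' : HasContinuousLogQuotient B a b) :
    HasContinuousLogQuotient (A ∪ B) a b := by
  classical
  obtain ⟨L, hL, h⟩ := h
  obtain ⟨M, hM, h'⟩ := h'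
  obtain ⟨M, hM, h', hLM⟩ : ∃ M : ℂ → ℂ, ContinuousOn M B ∧
      (∀ z ∈ B, Complex.exp (M z) = (z - a) / (z - b)) ∧ EqOn L M (A ∩ B) := by
    rcases (A ∩ B).eq_empty_or_nonempty with he | ⟨x, hx⟩
    · exact ⟨M, hM, h', by simp [he]⟩
    · refine ⟨fun z ↦ M z + (L x - M x), by fun_prop, fun z hz ↦ ?_, fun z hz ↦ ?_⟩
      · rw [Complex.exp_add, Complex.exp_sub, h x hx.1, ← h' x hx.2, h' z hz,
          div_self (Complex.exp_ne_zero _), mul_one]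
      · have := hAB.sub_eq_sub_of_exp_eq_exp (hL.mono inter_subset_left)
          (hM.mono inter_subset_right) (fun z hz ↦ (h z hz.1).trans (h' z hz.2).symm) hx hz
        simp only [this]
        ring
  have e1 : EqOn (A.piecewise L M) L A := piecewise_eqOn A L M
  have e2 : EqOn (A.piecewise L M) M B := fun z hz ↦ by
    by_cases hzA : z ∈ A
    · rw [e1 hzA, hLM ⟨hzA, hz⟩]
    · exact piecewise_eq_of_notMem _ _ _ hzA
  refine ⟨A.piecewise L M, (hL.congr e1).union_of_isClosed (hM.congr e2) hA hB, ?_⟩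
  rintro z (hz | hz)
  · rw [e1 hz, h z hz]
  · rw [e2 hz, h' z hz]

end HasContinuousLogQuotient

theorem Complex.exists_continuousOn_ball_exp_eq {g : ℂ → ℂ} {c : ℂ} {r : ℝ}
    (hg : ContinuousOn g (ball c r)) (h0 : ∀ z ∈ ball c r, g z ≠ 0) :
    ∃ f : ℂ → ℂ, ContinuousOn f (ball c r) ∧ ∀ z ∈ ball c r, Complex.exp (f z) = g z := by
  rcases le_or_gt r 0 with hr | hr
  · exact ⟨g, hg, by simp [ball_eq_empty.2 hr]⟩
  have : ContractibleSpace (ball c r) := contractibleSpace_ball hr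
  have hs : IsSimplyConnected (ball c r) := inferInstanceAs (SimplyConnectedSpace (ball c r))
  exact Complex.exists_continuousOn_eqOn_exp_comp hs isOpen_ball hg
    (by rintro ⟨z, hz, h⟩; exact h0 z hz h)

theorem HasContinuousLogQuotient.of_subset_ball {K : Set ℂ} {a b c : ℂ} {r : ℝ}
    (hK : K ⊆ ball c r) (ha : a ∉ ball c r) (hb : b ∉ ball c r) :
    HasContinuousLogQuotient K a b := by
  have h1 : ∀ z ∈ ball c r, z - a ≠ 0 := fun z hz h ↦ ha (sub_eq_zero.1 h ▸ hz)
  have h2 : ∀ z ∈ ball c r, z - b ≠ 0 := fun z hz h ↦ hb (sub_eq_zero.1 h ▸ hz)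
  obtain ⟨f, hf, h⟩ := Complex.exists_continuousOn_ball_exp_eq
    (g := fun z ↦ (z - a) / (z - b)) (c := c) (r := r)
    (ContinuousOn.div (by fun_prop) (by fun_prop) h2) (fun z hz ↦ div_ne_zero (h1 z hz) (h2 z hz))
  exact HasContinuousLogQuotient.mono ⟨f, hf, h⟩ hK

/-- There is no continuous logarithm on a circle around the origin. -/
theorem Complex.not_exists_continuousOn_sphere_exp_eq (c : ℂ) {r : ℝ} (hr : 0 < r) :
    ¬ ∃ f : ℂ → ℂ, ContinuousOn f (sphere c r) ∧ ∀ z ∈ sphere c r, Complex.exp (f z) = z - c := by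
  rintro ⟨f, hf, h⟩
  have hm : ∀ t : ℝ, circleMap c r t ∈ sphere c r := circleMap_mem_sphere c hr.le
  have := isPreconnected_univ.sub_eq_sub_of_exp_eq_exp (X := ℝ)
    (f := fun t ↦ f (circleMap c r t)) (g := fun t ↦ Real.log r + t * Complex.I)
    (hf.comp (continuous_circleMap c r).continuousOn fun t _ ↦ hm t) (by fun_prop)
    (fun t _ ↦ by
      rw [h _ (hm t), Complex.exp_add, ← Complex.ofReal_exp, Real.exp_log hr, circleMap,
        add_sub_cancel_left]) (mem_univ 0) (mem_univ (2 * Real.pi))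
  have h0 : circleMap c r (2 * Real.pi) = circleMap c r 0 := by simp [circleMap]
  rw [h0] at this
  simp at this

theorem Complex.isPreconnected_compl_closedBall (R : ℝ) :
    IsPreconnected ((closedBall (0 : ℂ) R)ᶜ) := by
  rcases lt_or_ge R 0 with hR | hR
  · rw [closedBall_eq_empty.2 hR, compl_empty]
    exact isPreconnected_univ
  have : (closedBall (0 : ℂ) R)ᶜ =
      (fun p : ℝ × ℝ ↦ (p.1 : ℂ) * Complex.exp (p.2 * Complex.I)) '' (Ioi R ×ˢ univ) := by
    ext z
    simp only [mem_compl_iff, mem_closedBall, dist_zero_right, not_le, mem_image, mem_prod,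
      mem_Ioi, mem_univ, and_true, Prod.exists]
    constructor
    · exact fun hz ↦ ⟨‖z‖, z.arg, hz, Complex.norm_mul_exp_arg_mul_I z⟩
    · rintro ⟨s, t, hs, rfl⟩
      rw [norm_mul, Complex.norm_exp_ofReal_mul_I, mul_one, Complex.norm_real]
      exact hs.trans_le (le_abs_self s)
  rw [this]
  exact (isPreconnected_Ioi.prod isPreconnected_univ).image _ (by fun_prop)

/-- A bounded component of the complement of a compact set containing `a` but not `b` obstructs
a continuous logarithm of `(z - a) / (z - b)`. -/
theorem HasContinuousLogQuotient.mem_of_isBounded {K U : Set ℂ} {a b : ℂ}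
    (hK : IsClosed K) (h : HasContinuousLogQuotient K a b) (hU : Bornology.IsBounded U)
    (hUK : frontier U ⊆ K) (hbK : b ∉ K) (ha : a ∈ U) : b ∈ U := by
  classical
  by_contra hb
  obtain ⟨L, hL, h⟩ := h
  obtain ⟨g, hg⟩ := ContinuousMap.exists_restrict_eq hK ⟨K.domRestrict L, hL.domRestrict⟩
  have hgL : ∀ z ∈ K, g z = L z := fun z hz ↦ DFunLike.congr_fun hg ⟨z, hz⟩
  have hb' : ∀ z ∈ closure U, z - b ≠ 0 := fun z hz h ↦ by
    rw [sub_eq_zero.1 h, closure_eq_self_union_frontier] at hz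
    exact hz.elim hb fun hz ↦ hbK (hUK hz)
  set H : ℂ → ℂ := U.piecewise (fun z ↦ Complex.exp (g z) * (z - b)) (fun z ↦ z - a) with hH
  have hHc : Continuous H := by
    rw [← continuousOn_univ]
    refine ContinuousOn.piecewise (fun z hz ↦ ?_) (by fun_prop) (by fun_prop)
    rw [hgL z (hUK hz.2), h z (hUK hz.2),
      div_mul_cancel₀ _ (hb' z (frontier_subset_closure hz.2))]
  have hH0 : ∀ z, H z ≠ 0 := fun z ↦ by
    by_cases hz : z ∈ U
    · rw [hH, piecewise_eq_of_mem _ _ _ hz]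
      exact mul_ne_zero (Complex.exp_ne_zero _) (hb' z (subset_closure hz))
    · rw [hH, piecewise_eq_of_notMem _ _ _ hz]
      exact fun h ↦ hz (sub_eq_zero.1 h ▸ ha)
  obtain ⟨R, hR, hUR⟩ := hU.subset_ball_lt 0 a
  obtain ⟨f, hf, hfH⟩ := Complex.exists_continuousOn_ball_exp_eq (c := a) (r := R + 1)
    hHc.continuousOn (fun z _ ↦ hH0 z)
  have hsub : sphere a R ⊆ ball a (R + 1) := fun z hz ↦ by
    rw [mem_sphere] at hz; rw [mem_ball]; linarith
  refine Complex.not_exists_continuousOn_sphere_exp_eq a hR ⟨f, hf.mono hsub, fun z hz ↦ ?_⟩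
  rw [hfH z (hsub hz), hH, piecewise_eq_of_notMem]
  exact fun hzU ↦ (mem_ball.1 (hUR hzU)).ne hz

theorem IsClosed.frontier_connectedComponentIn_compl_subset {X : Type*} [TopologicalSpace X]
    [LocallyConnectedSpace X] {K : Set X} (hK : IsClosed K) (a : X) :
    frontier (connectedComponentIn Kᶜ a) ⊆ K := by
  intro z hz
  by_contra hzK
  have hV := hK.isOpen_compl.connectedComponentIn (x := z)
  have hzV : z ∈ connectedComponentIn Kᶜ z := mem_connectedComponentIn hzK
  obtain ⟨w, hw, hw'⟩ := mem_closure_iff.1 (frontier_subset_closure hz) _ hV hzV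
  have := (connectedComponentIn_eq hw').trans (connectedComponentIn_eq hw).symm
  rw [(hK.isOpen_compl.connectedComponentIn (x := a)).frontier_eq] at hz
  exact hz.2 (this ▸ hzV)

/-- **Eilenberg's criterion** (hard direction). -/
theorem HasContinuousLogQuotient.mem_connectedComponentIn {K : Set ℂ} {a b : ℂ}
    (hK : IsCompact K) (h : HasContinuousLogQuotient K a b) (ha : a ∉ K) (hb : b ∉ K) :
    b ∈ connectedComponentIn Kᶜ a := by
  by_contra hab
  have hb' : b ∈ connectedComponentIn Kᶜ b := _root_.mem_connectedComponentIn hb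
  have ha' : a ∈ connectedComponentIn Kᶜ a := _root_.mem_connectedComponentIn ha
  have hba : a ∉ connectedComponentIn Kᶜ b := fun h ↦ hab (connectedComponentIn_eq h ▸ hb')
  obtain ⟨R, hR⟩ := hK.isBounded.subset_closedBall 0
  have key : ∀ x, ¬ Bornology.IsBounded (connectedComponentIn Kᶜ x) →
      (closedBall (0 : ℂ) R)ᶜ ⊆ connectedComponentIn Kᶜ x := fun x hx ↦ by
    have : ¬ connectedComponentIn Kᶜ x ⊆ closedBall 0 R :=
      fun h ↦ hx (isBounded_closedBall.subset h)
    obtain ⟨w, hw, hwR⟩ := not_subset.1 this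
    rw [connectedComponentIn_eq hw]
    exact (Complex.isPreconnected_compl_closedBall R).subset_connectedComponentIn hwR
      (compl_subset_compl.2 hR)
  by_cases hba1 : Bornology.IsBounded (connectedComponentIn Kᶜ a)
  · exact hab (h.mem_of_isBounded hK.isClosed hba1
      (hK.isClosed.frontier_connectedComponentIn_compl_subset a) hb ha')
  by_cases hba2 : Bornology.IsBounded (connectedComponentIn Kᶜ b)
  · exact hba (h.symm.mem_of_isBounded hK.isClosed hba2
      (hK.isClosed.frontier_connectedComponentIn_compl_subset b) ha hb')
  obtain ⟨w, hw⟩ : ((closedBall (0 : ℂ) R)ᶜ).Nonempty :=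
    ⟨(|R| + 1 : ℝ), by
      simp only [mem_compl_iff, mem_closedBall, dist_zero_right, Complex.norm_real, not_le,
        Real.norm_eq_abs]
      rw [abs_of_pos (by positivity)]
      linarith [le_abs_self R]⟩
  exact hab ((connectedComponentIn_eq (key a hba1 hw)).trans
    (connectedComponentIn_eq (key b hba2 hw)).symm ▸ hb')

theorem MeasureTheory.sq_lintegral_le_measure_univ_mul {α : Type*} [MeasurableSpace α]
    (μ : Measure α) {f : α → ℝ≥0∞} (hf : AEMeasurable f μ) :
    (∫⁻ x, f x ∂μ) ^ 2 ≤ μ univ * ∫⁻ x, f x ^ 2 ∂μ := by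
  have h := ENNReal.lintegral_mul_le_Lp_mul_Lq μ Real.HolderConjugate.two_two hf
    (aemeasurable_const (b := (1 : ℝ≥0∞)))
  simp only [Pi.mul_apply, mul_one, ENNReal.one_rpow, lintegral_const, one_mul] at h
  calc (∫⁻ x, f x ∂μ) ^ 2
      ≤ ((∫⁻ x, f x ^ (2 : ℝ) ∂μ) ^ (1 / 2 : ℝ) * μ univ ^ (1 / 2 : ℝ)) ^ 2 := by gcongr
    _ = μ univ * ∫⁻ x, f x ^ 2 ∂μ := by
      rw [mul_pow, ← ENNReal.rpow_natCast, ← ENNReal.rpow_natCast, ← ENNReal.rpow_mul,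
        ← ENNReal.rpow_mul]
      norm_num
      rw [mul_comm]

/-- The area of the image of an injective holomorphic map. -/
theorem DifferentiableOn.lintegral_enorm_deriv_sq {g : ℂ → ℂ} {U : Set ℂ} (hU : IsOpen U)
    (hg : DifferentiableOn ℂ g U) (hinj : InjOn g U) :
    ∫⁻ z in U, ‖_root_.deriv g z‖ₑ ^ 2 = volume (g '' U) := by
  have := lintegral_image_eq_lintegral_abs_det_fderiv_mul volume hU.measurableSet
    (f := g)
    (f' := fun z ↦
      (ContinuousLinearMap.toSpanSingleton ℂ (_root_.deriv g z)).restrictScalars ℝ)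
    (fun z hz ↦ ((hg.differentiableAt (hU.mem_nhds hz)).hasDerivAt.hasFDerivAt.restrictScalars
      ℝ).hasFDerivWithinAt) hinj (fun _ ↦ 1)
  simp only [lintegral_const, Measure.restrict_apply_univ, one_mul, mul_one] at this
  rw [this]
  refine lintegral_congr fun z ↦ ?_
  have : ((ContinuousLinearMap.toSpanSingleton ℂ (_root_.deriv g z)).restrictScalars ℝ).det
      = ‖_root_.deriv g z‖ ^ 2 := by
    simp [ContinuousLinearMap.det, LinearMap.det_restrictScalars,
      Algebra.norm_complex_eq, Complex.normSq_eq_norm_sq]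
  rw [this, abs_of_nonneg (by positivity), ENNReal.ofReal_pow (norm_nonneg _), ofReal_norm]

theorem circleMap_zero_mem_ball_one_iff {ρ t : ℝ} (hρ : 0 < ρ) :
    circleMap 0 ρ t ∈ ball (1 : ℂ) 1 ↔ ρ < 2 * Real.cos t := by
  have : ‖circleMap 0 ρ t - 1‖ ^ 2 = 1 + ρ * (ρ - 2 * Real.cos t) := by
    rw [← Complex.normSq_eq_norm_sq, Complex.normSq_apply]
    simp only [circleMap, zero_add, Complex.sub_re, Complex.re_ofReal_mul,
      Complex.exp_ofReal_mul_I_re, Complex.one_re, Complex.sub_im, Complex.im_ofReal_mul,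
      Complex.exp_ofReal_mul_I_im, Complex.one_im]
    linear_combination ρ ^ 2 * Real.sin_sq_add_cos_sq t
  rw [mem_ball, dist_eq_norm, ← sq_lt_one_iff₀ (norm_nonneg _), this]
  constructor
  · intro h
    by_contra! h'
    nlinarith [mul_nonneg hρ.le (sub_nonneg.2 h')]
  · intro h
    nlinarith [mul_pos hρ (sub_pos.2 h)]

theorem enorm_sub_sq_le_lintegral_circleMap {g : ℂ → ℂ}
    (hg : DifferentiableOn ℂ g (ball 1 1)) {ρ : ℝ} (hρ : 0 < ρ) {z w : ℂ}
    (hz : z ∈ ball (1 : ℂ) 1) (hw : w ∈ ball (1 : ℂ) 1) (hzρ : ‖z‖ = ρ) (hwρ : ‖w‖ = ρ) :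
    ‖g z - g w‖ₑ ^ 2 ≤ ENNReal.ofReal (2 * Real.pi) * (ENNReal.ofReal ρ ^ 2 *
      ∫⁻ t in Ioo (-Real.pi) Real.pi,
        (ball 1 1).indicator (fun z ↦ ‖deriv g z‖ₑ ^ 2) (circleMap 0 ρ t)) := by
  wlog hzw : w.arg ≤ z.arg generalizing z w
  · rw [enorm_sub_rev]
    exact this hw hz hwρ hzρ (le_of_not_ge hzw)
  have hpolar : ∀ {z : ℂ}, ‖z‖ = ρ → circleMap 0 ρ z.arg = z := fun {z} h ↦ by
    rw [circleMap, zero_add, ← h, Complex.norm_mul_exp_arg_mul_I]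
  rcases hzw.eq_or_lt with heq | hlt
  · have : z = w := by rw [← hpolar hzρ, ← heq, hpolar hwρ]
    simp [this]
  rw [← hpolar hzρ, circleMap_zero_mem_ball_one_iff hρ] at hz
  rw [← hpolar hwρ, circleMap_zero_mem_ball_one_iff hρ] at hw
  have hI : ∀ t ∈ Icc w.arg z.arg, circleMap 0 ρ t ∈ ball (1 : ℂ) 1 := fun t ht ↦ by
    rw [circleMap_zero_mem_ball_one_iff hρ, ← Real.cos_abs t]
    rcases le_max_iff.1 (abs_le_max_abs_abs ht.1 ht.2) with h | h
    · have := Real.cos_le_cos_of_nonneg_of_le_pi (abs_nonneg t) (Complex.abs_arg_le_pi w) h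
      rw [Real.cos_abs w.arg] at this
      linarith
    · have := Real.cos_le_cos_of_nonneg_of_le_pi (abs_nonneg t) (Complex.abs_arg_le_pi z) h
      rw [Real.cos_abs z.arg] at this
      linarith
  have hderiv : ∀ t ∈ Icc w.arg z.arg, HasDerivAt (fun t ↦ g (circleMap 0 ρ t))
      (deriv g (circleMap 0 ρ t) * (circleMap 0 ρ t * Complex.I)) t := fun t ht ↦
    (hg.differentiableAt (isOpen_ball.mem_nhds (hI t ht))).hasDerivAt.comp t
      (hasDerivAt_circleMap 0 ρ t)
  have hcont : ContDiffOn ℝ 1 (fun t ↦ g (circleMap 0 ρ t)) (Icc w.arg z.arg) :=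
    ((hg.contDiffOn isOpen_ball).restrict_scalars ℝ).comp (contDiff_circleMap 0 ρ).contDiffOn hI
  have h1 : ‖g z - g w‖ₑ ≤ ∫⁻ t in Icc w.arg z.arg,
      ‖deriv g (circleMap 0 ρ t)‖ₑ * ENNReal.ofReal ρ := by
    have := enorm_sub_le_lintegral_derivWithin_Icc_of_contDiffOn_Icc hcont hzw
    rw [hpolar hzρ, hpolar hwρ] at this
    refine this.trans (setLIntegral_mono' measurableSet_Icc fun t ht ↦ ?_)
    rw [((hderiv t ht).hasDerivWithinAt).derivWithin (uniqueDiffOn_Icc hlt t ht), enorm_mul]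
    gcongr
    rw [enorm_mul, ← ofReal_norm (circleMap 0 ρ t), norm_circleMap_zero, abs_of_pos hρ,
      ← ofReal_norm Complex.I, Complex.norm_I, ENNReal.ofReal_one, mul_one]
  have hmeas : Measurable fun t ↦ ‖deriv g (circleMap 0 ρ t)‖ₑ * ENNReal.ofReal ρ :=
    ((measurable_deriv g).comp (continuous_circleMap 0 ρ).measurable).enorm.mul_const _
  calc ‖g z - g w‖ₑ ^ 2
      ≤ (∫⁻ t in Icc w.arg z.arg, ‖deriv g (circleMap 0 ρ t)‖ₑ * ENNReal.ofReal ρ) ^ 2 := by gcongr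
    _ ≤ volume (Icc w.arg z.arg) * ∫⁻ t in Icc w.arg z.arg,
        (‖deriv g (circleMap 0 ρ t)‖ₑ * ENNReal.ofReal ρ) ^ 2 := by
      simpa using sq_lintegral_le_measure_univ_mul (volume.restrict (Icc w.arg z.arg))
        hmeas.aemeasurable
    _ ≤ _ := by
      gcongr
      · rw [Real.volume_Icc]
        gcongr
        linarith [Complex.arg_le_pi z, Complex.neg_pi_lt_arg w]
      · simp_rw [mul_pow, mul_comm _ (ENNReal.ofReal ρ ^ 2)]
        rw [lintegral_const_mul' _ _ (by finiteness)]
        refine mul_le_mul' le_rfl ?_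
        rw [restrict_Ioo_eq_restrict_Ioc]
        refine (setLIntegral_mono' measurableSet_Icc fun t ht ↦ ?_).trans
          (lintegral_mono_set (Icc_subset_Ioc (Complex.neg_pi_lt_arg w) (Complex.arg_le_pi z)))
        rw [indicator_of_mem (hI t ht)]

/-- **Wolff's lemma**: by the length-area principle, an injective holomorphic map with image of
finite area has small oscillation on arbitrarily small circular arcs around a boundary point. -/
theorem exists_radius_forall_dist_le {g : ℂ → ℂ} (hg : DifferentiableOn ℂ g (ball 1 1))
    (hinj : InjOn g (ball 1 1)) (hvol : volume (g '' ball 1 1) ≠ ∞) {ε δ : ℝ}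
    (hε : 0 < ε) (hδ : 0 < δ) :
    ∃ ρ ∈ Ioo 0 δ, ∀ z ∈ ball (1 : ℂ) 1, ∀ w ∈ ball (1 : ℂ) 1, ‖z‖ = ρ → ‖w‖ = ρ →
      dist (g z) (g w) ≤ ε := by
  by_contra! hcon
  set F : ℂ → ℝ≥0∞ := (ball 1 1).indicator (fun z ↦ ‖deriv g z‖ₑ ^ 2) with hF
  have hFm : Measurable F :=
    ((measurable_deriv g).enorm.pow_const 2).indicator isOpen_ball.measurableSet
  have hpi := Real.pi_pos
  have key : ∀ ρ ∈ Ioo 0 δ, ENNReal.ofReal (ε ^ 2 / (2 * Real.pi)) * ENNReal.ofReal ρ⁻¹ ≤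
      ∫⁻ t in Ioo (-Real.pi) Real.pi, ENNReal.ofReal ρ * F (circleMap 0 ρ t) := fun ρ hρ ↦ by
    obtain ⟨z, hz, w, hw, hzρ, hwρ, hzw⟩ := hcon ρ hρ
    have h := enorm_sub_sq_le_lintegral_circleMap hg hρ.1 hz hw hzρ hwρ
    rw [lintegral_const_mul' _ _ (by finiteness)]
    have h2 : ENNReal.ofReal (ε ^ 2) ≤ ‖g z - g w‖ₑ ^ 2 := by
      rw [← ofReal_norm, ← ENNReal.ofReal_pow (norm_nonneg _), ← dist_eq_norm]
      gcongr
    have h3 := h2.trans h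
    set J := ∫⁻ t in Ioo (-Real.pi) Real.pi, F (circleMap 0 ρ t)
    have e : ENNReal.ofReal (ε ^ 2 / (2 * Real.pi)) * ENNReal.ofReal ρ⁻¹ =
        ENNReal.ofReal ((2 * Real.pi)⁻¹ * ρ⁻¹) * ENNReal.ofReal (ε ^ 2) := by
      have := hρ.1
      rw [← ENNReal.ofReal_mul (by positivity), ← ENNReal.ofReal_mul (by positivity)]
      congr 1
      field_simp
    rw [e]
    refine (mul_le_mul_right h3 _).trans_eq ?_
    have := hρ.1
    rw [← ENNReal.ofReal_pow this.le, ← mul_assoc, ← mul_assoc,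
      ← ENNReal.ofReal_mul (by positivity), ← ENNReal.ofReal_mul (by positivity)]
    congr 2
    field_simp
  have hinv : ∫⁻ ρ in Ioo 0 δ, ENNReal.ofReal ρ⁻¹ = ∞ := by
    by_contra hne
    have : IntegrableOn (fun ρ : ℝ ↦ ρ⁻¹) (Ioo 0 δ) := by
      refine ⟨measurable_inv.aestronglyMeasurable, ?_⟩
      rw [hasFiniteIntegral_iff_ofReal]
      · exact lt_top_iff_ne_top.2 hne
      · filter_upwards [ae_restrict_mem measurableSet_Ioo] with x hx
        exact inv_nonneg.2 hx.1.le
    rw [← integrableOn_Ioc_iff_integrableOn_Ioo,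
      ← intervalIntegrable_iff_integrableOn_Ioc_of_le hδ.le, intervalIntegrable_inv_iff] at this
    simp [hδ.le, hδ.ne] at this
  have hsub : Ioo 0 δ ×ˢ Ioo (-Real.pi) Real.pi ⊆ Complex.polarCoord.target := by
    rw [Complex.polarCoord_target]
    exact prod_mono Ioo_subset_Ioi_self subset_rfl
  have hle : ∫⁻ ρ in Ioo 0 δ, ∫⁻ t in Ioo (-Real.pi) Real.pi,
      ENNReal.ofReal ρ * F (circleMap 0 ρ t) ≤ ∫⁻ z, F z := by
    rw [← Complex.lintegral_comp_polarCoord_symm]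
    refine le_trans (le_of_eq ?_) (lintegral_mono_set hsub)
    rw [Measure.volume_eq_prod, ← Measure.prod_restrict, lintegral_prod]
    · simp [circleMap, Complex.polarCoord_symm_apply, Complex.exp_mul_I]
    · refine Measurable.aemeasurable ?_
      simp only [smul_eq_mul, Complex.polarCoord_symm_apply]
      fun_prop
  refine hvol ?_
  rw [← hg.lintegral_enorm_deriv_sq isOpen_ball hinj,
    ← lintegral_indicator isOpen_ball.measurableSet, ← hF, eq_top_iff]
  refine le_trans ?_ hle
  refine le_trans ?_ (setLIntegral_mono' measurableSet_Ioo key)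
  rw [lintegral_const_mul' _ _ (by finiteness), hinv, ENNReal.mul_top]
  simpa using by positivity

/-- The inverse of a continuous injection on a compact set is uniformly continuous. -/
theorem IsCompact.exists_dist_lt_of_dist_lt {X Y : Type*} [MetricSpace X] [MetricSpace Y]
    {K : Set X} (hK : IsCompact K) {f : X → Y} (hf : ContinuousOn f K) (hinj : InjOn f K)
    {δ : ℝ} (hδ : 0 < δ) :
    ∃ η > 0, ∀ x ∈ K, ∀ y ∈ K, dist (f x) (f y) < η → dist x y < δ := by
  set P : Set (X × X) := (K ×ˢ K) ∩ {p | δ ≤ dist p.1 p.2} with hP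
  have hPc : IsCompact P :=
    (hK.prod hK).inter_right (isClosed_le continuous_const continuous_dist)
  have hc : ContinuousOn (fun p : X × X ↦ dist (f p.1) (f p.2)) P :=
    continuous_dist.comp_continuousOn ((hf.comp continuousOn_fst fun p hp ↦ hp.1.1).prodMk
      (hf.comp continuousOn_snd fun p hp ↦ hp.1.2))
  rcases P.eq_empty_or_nonempty with he | hne
  · refine ⟨1, one_pos, fun x hx y hy _ ↦ ?_⟩
    by_contra! h
    exact (he ▸ (⟨⟨hx, hy⟩, h⟩ : (x, y) ∈ P) : (x, y) ∈ (∅ : Set (X × X)))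
  · obtain ⟨p, hp, hmin⟩ := hPc.exists_isMinOn hne hc
    refine ⟨dist (f p.1) (f p.2), dist_pos.2 fun h ↦ ?_, fun x hx y hy hxy ↦ ?_⟩
    · have := hp.2
      rw [mem_ofPred_eq, hinj hp.1.1 hp.1.2 h, dist_self] at this
      linarith
    · by_contra! h
      exact hxy.not_ge (hmin (⟨⟨hx, hy⟩, h⟩ : (x, y) ∈ P))

/-- Arcs of the unit circle are connected. -/
theorem Complex.isPreconnected_sphere_inter_closedBall {s : ℂ} (hs : ‖s‖ = 1) (r : ℝ) :
    IsPreconnected (sphere (0 : ℂ) 1 ∩ closedBall s r) := by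
  rcases lt_or_ge r 0 with hr | hr
  · simp [closedBall_eq_empty.2 hr, isPreconnected_empty]
  set Θ : Set ℝ := {t | t ∈ Icc (-Real.pi) Real.pi ∧ 1 - r ^ 2 / 2 ≤ Real.cos t}
  have hΘ : Θ.OrdConnected := by
    refine ⟨fun x hx y hy t ht ↦ ⟨⟨hx.1.1.trans ht.1, ht.2.trans hy.1.2⟩, ?_⟩⟩
    rw [← Real.cos_abs t]
    rcases le_max_iff.1 (abs_le_max_abs_abs ht.1 ht.2) with h | h
    · have := Real.cos_le_cos_of_nonneg_of_le_pi (abs_nonneg t) (abs_le.2 hx.1) h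
      rw [Real.cos_abs x] at this
      exact hx.2.trans this
    · have := Real.cos_le_cos_of_nonneg_of_le_pi (abs_nonneg t) (abs_le.2 hy.1) h
      rw [Real.cos_abs y] at this
      exact hy.2.trans this
  have hdist : ∀ t : ℝ, s * Complex.exp (t * Complex.I) ∈ closedBall s r ↔
      1 - r ^ 2 / 2 ≤ Real.cos t := fun t ↦ by
    have h1 : ‖Complex.exp (t * Complex.I) - 1‖ ^ 2 = 2 - 2 * Real.cos t := by
      rw [← Complex.normSq_eq_norm_sq, Complex.normSq_apply]
      simp only [Complex.sub_re, Complex.exp_ofReal_mul_I_re, Complex.one_re, Complex.sub_im,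
        Complex.exp_ofReal_mul_I_im, Complex.one_im]
      linear_combination Real.sin_sq_add_cos_sq t
    have h2 : s * Complex.exp (t * Complex.I) - s = s * (Complex.exp (t * Complex.I) - 1) := by ring
    rw [mem_closedBall, dist_eq_norm, h2, norm_mul, hs, one_mul,
      ← sq_le_sq₀ (norm_nonneg _) hr, h1]
    constructor <;> intro h <;> linarith
  have : sphere (0 : ℂ) 1 ∩ closedBall s r =
      (fun t : ℝ ↦ s * Complex.exp (t * Complex.I)) '' Θ := by
    ext z
    constructor
    · rintro ⟨hz, hzr⟩
      have hs0 : s ≠ 0 := fun h ↦ by simp [h] at hs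
      have hz1 : ‖z / s‖ = 1 := by rw [norm_div, hs, div_one]; simpa using hz
      have he : s * Complex.exp ((z / s).arg * Complex.I) = z := by
        have := Complex.norm_mul_exp_arg_mul_I (z / s)
        rw [hz1, Complex.ofReal_one, one_mul] at this
        rw [this, mul_div_cancel₀ _ hs0]
      refine ⟨(z / s).arg, ⟨⟨(Complex.neg_pi_lt_arg _).le, Complex.arg_le_pi _⟩, ?_⟩, he⟩
      rw [← hdist, he]
      exact hzr
    · rintro ⟨t, ht, rfl⟩
      refine ⟨?_, (hdist t).2 ht.2⟩
      simp [hs, Complex.norm_exp_ofReal_mul_I]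
  rw [this]
  exact hΘ.isPreconnected.image _ (by fun_prop)

theorem Complex.isPreconnected_sphere_diff_singleton {s : ℂ} (hs : ‖s‖ = 1) :
    IsPreconnected (sphere (0 : ℂ) 1 \ {s}) := by
  have hs0 : s ≠ 0 := fun h ↦ by simp [h] at hs
  have : sphere (0 : ℂ) 1 \ {s} =
      (fun t : ℝ ↦ -s * Complex.exp (t * Complex.I)) '' Ioo (-Real.pi) Real.pi := by
    ext z
    constructor
    · rintro ⟨hz, hzs⟩
      have hz1 : ‖z / -s‖ = 1 := by rw [norm_div, norm_neg, hs, div_one]; simpa using hz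
      have he : -s * Complex.exp ((z / -s).arg * Complex.I) = z := by
        have := Complex.norm_mul_exp_arg_mul_I (z / -s)
        rw [hz1, Complex.ofReal_one, one_mul] at this
        rw [this, mul_div_cancel₀ _ (neg_ne_zero.2 hs0)]
      refine ⟨(z / -s).arg, ⟨Complex.neg_pi_lt_arg _, (Complex.arg_le_pi _).lt_of_ne fun h ↦ ?_⟩,
        he⟩
      rw [h, Complex.exp_pi_mul_I] at he
      exact hzs (by simpa using he.symm)
    · rintro ⟨t, ht, rfl⟩
      refine ⟨by simp [hs, Complex.norm_exp_ofReal_mul_I], fun h ↦ ht.2.ne ?_⟩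
      have h1 : Complex.exp (t * Complex.I) = -1 := by
        have h2 : -s * Complex.exp (t * Complex.I) = s := h
        have h3 : s * (Complex.exp (t * Complex.I) + 1) = 0 := by linear_combination -h2
        exact eq_neg_of_add_eq_zero_left ((mul_eq_zero.1 h3).resolve_left hs0)
      have h2 := Complex.log_exp (x := t * Complex.I) (by simpa using ht.1) (by simpa using ht.2.le)
      rw [h1, Complex.log_neg_one] at h2
      exact_mod_cast (mul_right_cancel₀ Complex.I_ne_zero h2).symm
  rw [this]
  exact isPreconnected_Ioo.image _ (by fun_prop)

/-- Subsets of small diameter of a Jordan curve lie in small subarcs. -/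
theorem exists_isPreconnected_superset_of_dist_lt {f : ℂ → ℂ}
    (hf : ContinuousOn f (sphere 0 1)) (hinj : InjOn f (sphere 0 1)) {ε : ℝ} (hε : 0 < ε) :
    ∃ η > 0, ∀ E ⊆ f '' sphere 0 1, (∀ x ∈ E, ∀ y ∈ E, dist x y < η) →
      ∃ S ⊆ f '' sphere 0 1, E ⊆ S ∧ IsClosed S ∧ IsPreconnected S ∧
        ∀ x ∈ S, ∃ e ∈ E, dist x e < ε := by
  have hT : IsCompact (sphere (0 : ℂ) 1) := isCompact_sphere 0 1
  obtain ⟨δ, hδ, hfδ⟩ := Metric.uniformContinuousOn_iff.1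
    (hT.uniformContinuousOn_of_continuous hf) ε hε
  obtain ⟨η, hη, hfη⟩ := hT.exists_dist_lt_of_dist_lt hf hinj (half_pos hδ)
  refine ⟨η, hη, fun E hE hEη ↦ ?_⟩
  rcases E.eq_empty_or_nonempty with rfl | ⟨e, he⟩
  · exact ⟨∅, by simp, subset_rfl, isClosed_empty, isPreconnected_empty, by simp⟩
  obtain ⟨s, hs, rfl⟩ := hE he
  have hs1 : ‖s‖ = 1 := by simpa using hs
  refine ⟨f '' (sphere 0 1 ∩ closedBall s (δ / 2)), image_mono inter_subset_left, fun x hx ↦ ?_,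
    ?_, ?_, ?_⟩
  · obtain ⟨t, ht, rfl⟩ := hE hx
    exact ⟨t, ⟨ht, (hfη t ht s hs (hEη _ hx _ he)).le⟩, rfl⟩
  · exact ((hT.inter_right isClosed_closedBall).image_of_continuousOn
      (hf.mono inter_subset_left)).isClosed
  · exact (Complex.isPreconnected_sphere_inter_closedBall hs1 _).image _
      (hf.mono inter_subset_left)
  · rintro _ ⟨t, ht, rfl⟩
    exact ⟨f s, he, hfδ t ht.1 s hs (lt_of_le_of_lt (mem_closedBall.1 ht.2) (by linarith))⟩

theorem exists_isPreconnected_subset_diff {G A : Set ℂ} {a b : ℂ} (hG : IsOpen G)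
    (hGc : IsPreconnected G) (hGb : Bornology.IsBounded G) (hA : IsCompact A)
    (hAG : IsPreconnected (A ∩ frontier G)) (ha : a ∈ G \ A) (hb : b ∈ G \ A)
    (h : HasContinuousLogQuotient A a b) :
    ∃ S ⊆ G \ A, IsPreconnected S ∧ a ∈ S ∧ b ∈ S := by
  have hGf : Disjoint G (frontier G) := by
    rw [hG.frontier_eq]; exact disjoint_sdiff_right
  have hF : IsCompact (frontier G) :=
    hGb.isCompact_closure.of_isClosed_subset isClosed_frontier frontier_subset_closure
  have hAF := h.union hA.isClosed isClosed_frontier hAG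
    (HasContinuousLogQuotient.of_isPreconnected isClosed_frontier hGc hGf ha.1 hb.1)
  have ha' : a ∉ A ∪ frontier G := fun h ↦ h.elim ha.2 (disjoint_left.1 hGf ha.1)
  have hb' : b ∉ A ∪ frontier G := fun h ↦ h.elim hb.2 (disjoint_left.1 hGf hb.1)
  have hbS := hAF.mem_connectedComponentIn (hA.union hF) ha' hb'
  have hsub := connectedComponentIn_subset (A ∪ frontier G)ᶜ a
  have haS := mem_connectedComponentIn (mem_compl ha')
  refine ⟨connectedComponentIn (A ∪ frontier G)ᶜ a, subset_sdiff.2 ⟨?_, ?_⟩,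
    isPreconnected_connectedComponentIn, haS, hbS⟩
  · refine isPreconnected_connectedComponentIn.subset_left_of_subset_union hG
      isClosed_closure.isOpen_compl (v := (closure G)ᶜ)
      (disjoint_compl_right.mono_left subset_closure) (fun z hz ↦ ?_) ⟨a, haS, ha.1⟩
    by_cases hzG : z ∈ closure G
    · rw [closure_eq_self_union_frontier] at hzG
      exact .inl (hzG.resolve_right fun h ↦ hsub hz (.inr h))
    · exact .inr hzG
  · exact disjoint_left.2 fun z hz hzA ↦ hsub hz (.inl hzA)

theorem DifferentiableOn.isOpen_image_of_injOn {ψ : ℂ → ℂ} {U s : Set ℂ} (hU : IsOpen U)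
    (hUc : IsPreconnected U) (hψ : DifferentiableOn ℂ ψ U) (hinj : InjOn ψ U) (hs : IsOpen s)
    (hsU : s ⊆ U) : IsOpen (ψ '' s) := by
  rcases s.eq_empty_or_nonempty with rfl | ⟨x, hx⟩
  · simp
  rcases (hψ.analyticOnNhd hU).is_constant_or_isOpen hUc with ⟨w, hw⟩ | h
  · have hsub : s ⊆ {x} := fun y hy ↦ hinj (hsU hy) (hsU hx) ((hw y (hsU hy)).trans
      (hw x (hsU hx)).symm)
    exact absurd hs ((subset_antisymm hsub (singleton_subset_iff.2 hx)) ▸ not_isOpen_singleton x)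
  · exact h s hsU hs

/-- A compact set containing the image of `{u = 0}` separates the images of `{u > 0}` and
`{u < 0}`, provided that it meets the boundary of the domain in a connected set. -/
theorem not_hasContinuousLogQuotient_of_separates {G A U : Set ℂ} {ψ : ℂ → ℂ} {u : ℂ → ℝ}
    (hU : IsOpen U) (hUc : IsPreconnected U) (hψ : DifferentiableOn ℂ ψ U) (hinj : InjOn ψ U)
    (hψG : ψ '' U = G) (hGb : Bornology.IsBounded G) (hA : IsCompact A)
    (hAG : IsPreconnected (A ∩ frontier G)) (hu : Continuous u)
    (huA : ∀ z ∈ U, u z = 0 → ψ z ∈ A) {p q : ℂ} (hp : p ∈ U) (hq : q ∈ U) (hup : 0 < u p)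
    (huq : u q < 0) (hpA : ψ p ∉ A) (hqA : ψ q ∉ A) :
    ¬ HasContinuousLogQuotient A (ψ p) (ψ q) := by
  intro h
  have hG : IsOpen G := hψG ▸ hψ.isOpen_image_of_injOn hU hUc hinj hU subset_rfl
  have hGc : IsPreconnected G := hψG ▸ hUc.image ψ hψ.continuousOn
  obtain ⟨S, hSG, hS, hpS, hqS⟩ := exists_isPreconnected_subset_diff hG hGc hGb hA hAG
    ⟨hψG ▸ mem_image_of_mem ψ hp, hpA⟩ ⟨hψG ▸ mem_image_of_mem ψ hq, hqA⟩ h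
  have hpos : IsOpen (ψ '' (U ∩ {z | 0 < u z})) := hψ.isOpen_image_of_injOn hU hUc hinj
    (hU.inter (isOpen_lt continuous_const hu)) inter_subset_left
  have hneg : IsOpen (ψ '' (U ∩ {z | u z < 0})) := hψ.isOpen_image_of_injOn hU hUc hinj
    (hU.inter (isOpen_lt hu continuous_const)) inter_subset_left
  have hdisj : Disjoint (ψ '' (U ∩ {z | 0 < u z})) (ψ '' (U ∩ {z | u z < 0})) := by
    rw [disjoint_left]
    rintro _ ⟨x, ⟨hxU, hx⟩, rfl⟩ ⟨y, ⟨hyU, hy⟩, hxy⟩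
    rw [hinj hyU hxU hxy] at hy
    exact lt_asymm (show 0 < u x from hx) (show u x < 0 from hy)
  have hsub : S ⊆ ψ '' (U ∩ {z | 0 < u z}) ∪ ψ '' (U ∩ {z | u z < 0}) := fun w hw ↦ by
    obtain ⟨z, hz, rfl⟩ := hψG.symm ▸ (hSG hw).1
    rcases lt_trichotomy (u z) 0 with h | h | h
    · exact .inr ⟨z, ⟨hz, h⟩, rfl⟩
    · exact absurd (huA z hz h) (hSG hw).2
    · exact .inl ⟨z, ⟨hz, h⟩, rfl⟩
  exact disjoint_left.1 hdisj
    (hS.subset_left_of_subset_union hpos hneg hdisj hsub ⟨_, hpS, p, ⟨hp, hup⟩, rfl⟩ hqS)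
    ⟨q, ⟨hq, huq⟩, rfl⟩

/-- Circular cross-cuts with small images accumulate at every point of the unit circle. -/
theorem exists_crosscut_dist_le {ψ : ℂ → ℂ} (hψ : DifferentiableOn ℂ ψ (ball 0 1))
    (hinj : InjOn ψ (ball 0 1)) (hb : Bornology.IsBounded (ψ '' ball 0 1)) {ζ : ℂ}
    (hζ : ‖ζ‖ = 1) {ε : ℝ} (hε : 0 < ε) :
    ∃ ρ ∈ Ioo (0 : ℝ) 1, ∀ z ∈ ball (0 : ℂ) 1, ∀ w ∈ ball (0 : ℂ) 1, dist z ζ = ρ →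
      dist w ζ = ρ → dist (ψ z) (ψ w) ≤ ε := by
  have hζ0 : ζ ≠ 0 := fun h ↦ by simp [h] at hζ
  have hmaps : MapsTo (fun z ↦ ζ * (1 - z)) (ball (1 : ℂ) 1) (ball 0 1) := fun z hz ↦ by
    rw [mem_ball', dist_eq_norm] at hz
    simpa [hζ] using hz
  obtain ⟨ρ, hρ, h⟩ := exists_radius_forall_dist_le (g := fun z ↦ ψ (ζ * (1 - z)))
    (hψ.comp (by fun_prop) hmaps)
    (fun z hz w hw hzw ↦ by
      have := mul_left_cancel₀ hζ0 (hinj (hmaps hz) (hmaps hw) hzw)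
      linear_combination -this)
    (ne_top_of_le_ne_top hb.measure_lt_top.ne (measure_mono <| by
      rintro _ ⟨z, hz, rfl⟩
      exact mem_image_of_mem ψ (hmaps hz))) hε one_pos
  refine ⟨ρ, hρ, fun z hz w hw hzρ hwρ ↦ ?_⟩
  have key : ∀ z : ℂ, ζ * (1 - (1 - z / ζ)) = z := fun z ↦ by field_simp; ring
  have hn : ∀ z : ℂ, ‖1 - z / ζ‖ = dist z ζ := fun z ↦ by
    rw [← div_self hζ0, ← sub_div, norm_div, hζ, div_one, ← dist_eq_norm, dist_comm]
  have hm : ∀ z ∈ ball (0 : ℂ) 1, 1 - z / ζ ∈ ball (1 : ℂ) 1 := fun z hz ↦ by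
    have : 1 - z / ζ - 1 = - (z / ζ) := by ring
    rw [mem_ball, dist_eq_norm, this, norm_neg, norm_div, hζ, div_one]
    simpa using hz
  simpa only [key] using h _ (hm z hz) _ (hm w hw) ((hn z).trans hzρ) ((hn w).trans hwρ)

theorem exists_ball_forall_dist_le {ψ f : ℂ → ℂ} (hψ : DifferentiableOn ℂ ψ (ball 0 1))
    (hinj : InjOn ψ (ball 0 1)) (hb : Bornology.IsBounded (ψ '' ball 0 1))
    (hf : ContinuousOn f (sphere 0 1)) (hfi : InjOn f (sphere 0 1))
    (hfr : frontier (ψ '' ball 0 1) = f '' sphere 0 1) {ζ : ℂ} (hζ : ‖ζ‖ = 1) {ε : ℝ}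
    (hε : 0 < ε) :
    ∃ ρ > 0, ∀ z ∈ ball (0 : ℂ) 1 ∩ ball ζ ρ, ∀ w ∈ ball (0 : ℂ) 1 ∩ ball ζ ρ,
      dist (ψ z) (ψ w) ≤ ε := by
  have hp₁ : (0 : ℂ) ∈ ball (0 : ℂ) 1 := by simp
  have hp₂ : -ζ / 2 ∈ ball (0 : ℂ) 1 := by simp [hζ]; norm_num
  have hd : 0 < dist (ψ 0) (ψ (-ζ / 2)) := dist_pos.2 fun h ↦ by
    have := congrArg norm (hinj hp₁ hp₂ h)
    simp [hζ] at this
  obtain ⟨r, hr, hrε, hrd⟩ : ∃ r > 0, 2 * r ≤ ε ∧ 2 * r ≤ dist (ψ 0) (ψ (-ζ / 2)) :=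
    ⟨min ε (dist (ψ 0) (ψ (-ζ / 2))) / 2, by positivity,
      by linarith [min_le_left ε (dist (ψ 0) (ψ (-ζ / 2)))],
      by linarith [min_le_right ε (dist (ψ 0) (ψ (-ζ / 2)))]⟩
  obtain ⟨η, hη, hS⟩ := exists_isPreconnected_superset_of_dist_lt hf hfi (half_pos hr)
  obtain ⟨κ, hκ, hκη, hκr⟩ : ∃ κ > 0, 2 * κ < η ∧ κ < r / 2 :=
    ⟨min η r / 3, by positivity, by linarith [min_le_left η r], by linarith [min_le_right η r]⟩
  obtain ⟨ρ, ⟨hρ0, hρ1⟩, hρ⟩ := exists_crosscut_dist_le hψ hinj hb hζ hκ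
  have hc₁ : (1 - ρ) * ζ ∈ ball (0 : ℂ) 1 := by
    have : ‖(1 - ρ : ℂ)‖ = 1 - ρ := by
      rw [← Complex.ofReal_one, ← Complex.ofReal_sub, Complex.norm_of_nonneg (by linarith)]
    rw [mem_ball_zero_iff, norm_mul, hζ, this]
    linarith
  have hc₂ : dist ((1 - ρ) * ζ) ζ = ρ := by
    have : (1 - ρ) * ζ - ζ = -(ρ * ζ) := by ring
    rw [dist_eq_norm, this, norm_neg, norm_mul, hζ, mul_one, Complex.norm_of_nonneg hρ0.le]
  set c := ψ ((1 - ρ) * ζ)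
  set A₀ := closure (ψ '' (ball 0 1 ∩ sphere ζ ρ)) with hA₀
  have hA₀c : A₀ ⊆ closedBall c κ := closure_minimal (by
    rintro _ ⟨z, hz, rfl⟩
    exact hρ z hz.1 _ hc₁ hz.2 hc₂) isClosed_closedBall
  obtain ⟨S, hSf, hES, hSc, hSp, hSE⟩ := hS (A₀ ∩ f '' sphere 0 1) inter_subset_right
    fun x hx y hy ↦ by
      have h1 := mem_closedBall.1 (hA₀c hx.1)
      have h2 := mem_closedBall'.1 (hA₀c hy.1)
      linarith [dist_triangle x c y]
  have hAc : IsCompact (A₀ ∪ S) :=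
    ((isCompact_closedBall c κ).of_isClosed_subset isClosed_closure hA₀c).union
      (((isCompact_sphere 0 1).image_of_continuousOn hf).of_isClosed_subset hSc hSf)
  have hAr : A₀ ∪ S ⊆ ball c r := union_subset
    (hA₀c.trans (closedBall_subset_ball (by linarith))) fun x hx ↦ by
      obtain ⟨e, he, hxe⟩ := hSE x hx
      have := mem_closedBall.1 (hA₀c he.1)
      rw [mem_ball]
      linarith [dist_triangle x e c]
  have hAS : (A₀ ∪ S) ∩ f '' sphere 0 1 = S := by
    rw [union_inter_distrib_right, inter_eq_left.2 hSf]
    exact union_eq_right.2 hES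
  have hsep : ∀ p ∈ ball (0 : ℂ) 1, ∀ q ∈ ball (0 : ℂ) 1, ρ < dist p ζ → dist q ζ < ρ →
      ψ p ∉ ball c r → ψ q ∈ ball c r := by
    intro p hp q hq hpρ hqρ hpc
    by_contra hqc
    refine not_hasContinuousLogQuotient_of_separates (u := fun z ↦ dist z ζ - ρ) isOpen_ball
      (convex_ball _ _).isPreconnected hψ hinj rfl hb hAc (by rwa [hfr, hAS]) (by fun_prop)
      (fun z hz h ↦ .inl <| subset_closure ⟨z, ⟨hz, sub_eq_zero.1 h⟩, rfl⟩) hp hq (sub_pos.2 hpρ)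
      (sub_neg.2 hqρ) (fun h ↦ hpc (hAr h)) (fun h ↦ hqc (hAr h)) ?_
    exact .of_subset_ball hAr hpc hqc
  obtain ⟨p, hp, hpρ, hpc⟩ : ∃ p ∈ ball (0 : ℂ) 1, ρ < dist p ζ ∧ ψ p ∉ ball c r := by
    by_contra! h
    have h1 := mem_ball.1 (h 0 hp₁ (by rw [dist_comm, dist_zero_right, hζ]; exact hρ1))
    have h2 := mem_ball'.1 (h _ hp₂ (by
      have : -ζ / 2 - ζ = -(3 / 2 * ζ) := by ring
      rw [dist_eq_norm, this, norm_neg, norm_mul, hζ]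
      norm_num
      linarith))
    linarith [dist_triangle (ψ 0) c (ψ (-ζ / 2))]
  refine ⟨ρ, hρ0, fun z hz w hw ↦ ?_⟩
  have h1 := mem_ball.1 (hsep p hp z hz.1 hpρ hz.2 hpc)
  have h2 := mem_ball'.1 (hsep p hp w hw.1 hpρ hw.2 hpc)
  linarith [dist_triangle (ψ z) c (ψ w)]

/-- A conformal map of the disc onto a Jordan domain extends continuously to the closed disc. -/
theorem exists_continuousOn_closedBall_eqOn {ψ f : ℂ → ℂ} (hψ : DifferentiableOn ℂ ψ (ball 0 1))
    (hinj : InjOn ψ (ball 0 1)) (hb : Bornology.IsBounded (ψ '' ball 0 1))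
    (hf : ContinuousOn f (sphere 0 1)) (hfi : InjOn f (sphere 0 1))
    (hfr : frontier (ψ '' ball 0 1) = f '' sphere 0 1) :
    ∃ Ψ : ℂ → ℂ, ContinuousOn Ψ (closedBall 0 1) ∧ EqOn Ψ ψ (ball 0 1) := by
  have hcl : closedBall (0 : ℂ) 1 = closure (ball 0 1) := (closure_ball _ one_ne_zero).symm
  have hlim : ∀ x ∈ closedBall (0 : ℂ) 1, ∃ y, Tendsto ψ (𝓝[ball 0 1] x) (𝓝 y) := by
    intro x hx
    rcases (mem_closedBall_zero_iff.1 hx).lt_or_eq with h | h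
    · exact ⟨ψ x, hψ.continuousOn x (mem_ball_zero_iff.2 h)⟩
    · have : (𝓝[ball 0 1] x).NeBot := mem_closure_iff_nhdsWithin_neBot.1 (hcl ▸ hx)
      refine cauchy_map_iff_exists_tendsto.1 (Metric.cauchy_iff.2 ⟨inferInstance, fun ε hε ↦ ?_⟩)
      obtain ⟨ρ, hρ, hd⟩ := exists_ball_forall_dist_le hψ hinj hb hf hfi hfr h (half_pos hε)
      refine ⟨ψ '' (ball 0 1 ∩ ball x ρ), image_mem_map (inter_mem self_mem_nhdsWithin
        (mem_nhdsWithin_of_mem_nhds (ball_mem_nhds x hρ))), ?_⟩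
      rintro _ ⟨z, hz, rfl⟩ _ ⟨w, hw, rfl⟩
      linarith [hd z hz w hw]
  exact ⟨extendFrom (ball 0 1) ψ, continuousOn_extendFrom hcl.subset hlim, fun x hx ↦
    extendFrom_eq (subset_closure hx) (hψ.continuousOn x hx)⟩

/-- The extension maps the unit circle to the boundary. -/
theorem mapsTo_sphere_frontier {ψ Ψ : ℂ → ℂ} (hψ : DifferentiableOn ℂ ψ (ball 0 1))
    (hinj : InjOn ψ (ball 0 1)) (hΨ : ContinuousOn Ψ (closedBall 0 1))
    (hΨψ : EqOn Ψ ψ (ball 0 1)) : MapsTo Ψ (sphere 0 1) (frontier (ψ '' ball 0 1)) := by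
  intro ζ hζ
  have hζ' := sphere_subset_closedBall hζ
  have hcl : closedBall (0 : ℂ) 1 = closure (ball 0 1) := (closure_ball _ one_ne_zero).symm
  have hne : (𝓝[ball 0 1] ζ).NeBot := mem_closure_iff_nhdsWithin_neBot.1 (hcl ▸ hζ')
  have ht : Tendsto ψ (𝓝[ball 0 1] ζ) (𝓝 (Ψ ζ)) :=
    ((hΨ ζ hζ').mono_left (nhdsWithin_mono _ ball_subset_closedBall)).congr'
      (eventually_mem_nhdsWithin.mono fun z hz ↦ hΨψ hz)
  have hopen {s : Set ℂ} (hs : IsOpen s) (hsU : s ⊆ ball 0 1) : IsOpen (ψ '' s) :=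
    hψ.isOpen_image_of_injOn isOpen_ball (convex_ball _ _).isPreconnected hinj hs hsU
  rw [(hopen isOpen_ball subset_rfl).frontier_eq]
  refine ⟨mem_closure_of_tendsto ht (eventually_mem_nhdsWithin.mono fun z hz ↦
    mem_image_of_mem ψ hz), ?_⟩
  rintro ⟨p, hp, hpζ⟩
  have hp1 : ‖p‖ < 1 := mem_ball_zero_iff.1 hp
  obtain ⟨s, hps, hs1⟩ := exists_between hp1
  have hs : ψ '' ball 0 s ∈ 𝓝 (Ψ ζ) := (hopen isOpen_ball (ball_subset_ball hs1.le)).mem_nhds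
    ⟨p, mem_ball_zero_iff.2 hps, hpζ⟩
  have hfar : {z : ℂ | s < ‖z‖} ∈ 𝓝 ζ :=
    (isOpen_lt continuous_const continuous_norm).mem_nhds (by
      have : ‖ζ‖ = 1 := by simpa using hζ
      show s < ‖ζ‖
      rw [this]; exact hs1)
  obtain ⟨z, ⟨hz, w, hw, hwz⟩, hzs⟩ := ((eventually_mem_nhdsWithin.and (ht.eventually hs)).and
    (mem_nhdsWithin_of_mem_nhds hfar)).exists
  have := hinj (ball_subset_ball hs1.le hw) hz hwz
  rw [← this] at hzs
  exact lt_asymm hzs (mem_ball_zero_iff.1 hw)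

/-- A disc algebra function that is constant on an arc of the circle takes that value at `0`. -/
theorem eq_of_forall_mem_arc {Ψ : ℂ → ℂ} (hΨ : DiffContOnCl ℂ Ψ (ball 0 1)) {ω w : ℂ}
    (hω : ‖ω‖ = 1) {c : ℝ} (hc : c < 1)
    (h : ∀ z : ℂ, ‖z‖ = 1 → c < (z * starRingEnd ℂ ω).re → Ψ z = w) : Ψ 0 = w := by
  have hself : ∀ x : ℂ, ‖x‖ = 1 → x * starRingEnd ℂ x = 1 := fun x hx ↦ by
    rw [Complex.mul_conj, Complex.normSq_eq_norm_sq, hx]; simp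
  obtain ⟨t, ht, htc⟩ := (isCompact_sphere (0 : ℂ) 1).elim_nhds_subcover
    (fun x ↦ {z | c < (z * starRingEnd ℂ x).re}) fun x hx ↦
      (isOpen_lt continuous_const (by fun_prop)).mem_nhds (by
        show c < (x * starRingEnd ℂ x).re
        rw [hself x (by simpa using hx)]
        exact hc)
  set P : ℂ → ℂ := fun z ↦ ∏ x ∈ t, (Ψ (z * (starRingEnd ℂ x * ω)) - w)
  have hrot : ∀ x ∈ t, ‖starRingEnd ℂ x * ω‖ = 1 := fun x hx ↦ by
    have : ‖x‖ = 1 := by simpa using ht x hx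
    rw [norm_mul, RCLike.norm_conj, this, hω, one_mul]
  have hP : DiffContOnCl ℂ P (ball 0 1) := by
    have hcl : closure (ball (0 : ℂ) 1) = closedBall 0 1 := closure_ball _ one_ne_zero
    constructor
    · refine DifferentiableOn.fun_finsetProd fun x hx ↦ DifferentiableOn.sub_const
        (hΨ.differentiableOn.comp (by fun_prop) fun z hz ↦ ?_) w
      rwa [mem_ball_zero_iff, norm_mul, hrot x hx, mul_one, ← mem_ball_zero_iff]
    · refine continuousOn_finsetProd _ fun x hx ↦ ContinuousOn.sub
        (hΨ.continuousOn.comp (by fun_prop) fun z hz ↦ ?_) continuousOn_const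
      rw [hcl] at hz ⊢
      rw [mem_closedBall_zero_iff] at hz ⊢
      rwa [norm_mul, hrot x hx, mul_one]
  have hP0 : P 0 = 0 := by
    have := Complex.norm_le_of_forall_mem_frontier_norm_le (C := 0) isBounded_ball hP
      (fun z hz ↦ ?_) (z := 0) (subset_closure (by simp))
    · simpa using this
    rw [frontier_ball _ one_ne_zero] at hz
    obtain ⟨x, hx, hzx⟩ := mem_iUnion₂.1 (htc hz)
    have hz1 : ‖z‖ = 1 := by simpa using hz
    have : P z = 0 := Finset.prod_eq_zero hx (sub_eq_zero.2 (h _ ?_ ?_))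
    · simp [this]
    · rw [norm_mul, hz1, hrot x hx, one_mul]
    · rwa [mul_assoc, mul_assoc, hself ω hω, mul_one]
  obtain ⟨x, hx, hx0⟩ := Finset.prod_eq_zero_iff.1 hP0
  rw [zero_mul] at hx0
  exact sub_eq_zero.1 hx0

/-- A chord of the unit circle lies on a line that meets the circle only at its endpoints. -/
theorem Complex.exists_chord {a b : ℂ} (ha : ‖a‖ = 1) (hb : ‖b‖ = 1) (hab : a ≠ b) :
    ∃ ω : ℂ, ‖ω‖ = 1 ∧ ∃ c ∈ Ioo (-1 : ℝ) 1,
      ∀ z : ℂ, ‖z‖ = 1 → (z * starRingEnd ℂ ω).re = c → z = a ∨ z = b := by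
  have hself : ∀ x : ℂ, ‖x‖ = 1 → x * starRingEnd ℂ x = 1 := fun x hx ↦ by
    rw [Complex.mul_conj, Complex.normSq_eq_norm_sq, hx]; simp
  obtain ⟨ω, hω⟩ := IsAlgClosed.exists_pow_nat_eq (a * b) two_pos
  have hω1 : ‖ω‖ = 1 := by
    have := congrArg norm hω
    rw [norm_pow, norm_mul, ha, hb, one_mul] at this
    exact (pow_eq_one_iff_of_nonneg (norm_nonneg _) two_ne_zero).1 this
  have hωω := hself ω hω1
  have hnorm : ∀ z : ℂ, ‖z‖ = 1 → ‖z * starRingEnd ℂ ω‖ = 1 := fun z hz ↦ by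
    rw [norm_mul, RCLike.norm_conj, hz, hω1, one_mul]
  have hcancel : ∀ x y : ℂ, x * starRingEnd ℂ ω = y * starRingEnd ℂ ω → x = y := fun x y h ↦
    mul_right_cancel₀ (right_ne_zero_of_mul_eq_one hωω) h
  set u := a * starRingEnd ℂ ω with hu
  set v := b * starRingEnd ℂ ω with hv
  have huu : u * starRingEnd ℂ u = 1 := hself u (hnorm a ha)
  have huv : u * v = 1 := by
    have : u * v = (ω * starRingEnd ℂ ω) ^ 2 := by
      rw [hu, hv, mul_pow, hω]; ring
    rw [this, hωω, one_pow]
  have hvu : v = starRingEnd ℂ u :=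
    mul_left_cancel₀ (left_ne_zero_of_mul_eq_one huu) (huv.trans huu.symm)
  have him : u.im ≠ 0 := fun h ↦ hab <| hcancel a b <| by
    rw [← hu, ← hv, hvu, Complex.conj_eq_iff_im.2 h]
  refine ⟨ω, hω1, u.re, ?_, fun z hz hzc ↦ ?_⟩
  · have := Complex.abs_re_lt_norm.2 him
    rw [hnorm a ha] at this
    exact abs_lt.1 this
  · set y := z * starRingEnd ℂ ω with hy
    have hyy : y * starRingEnd ℂ y = 1 := hself y (hnorm z hz)
    have h1 := Complex.add_conj u
    have h2 := Complex.add_conj y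
    rw [← hvu] at h1
    rw [hzc, ← h1] at h2
    have h3 : (y - u) * (y - v) = 0 := by linear_combination huv - hyy + y * h2
    rcases mul_eq_zero.1 h3 with h | h
    · exact .inl (hcancel _ _ (sub_eq_zero.1 h))
    · exact .inr (hcancel _ _ (sub_eq_zero.1 h))

theorem exists_mem_connectedComponentIn_of_arc {Ψ : ℂ → ℂ} {J : Set ℂ} {ω w : ℂ} {c : ℝ}
    (hΨ : DiffContOnCl ℂ Ψ (ball 0 1)) (hω : ‖ω‖ = 1) (hc : c < 1) (h0 : Ψ 0 ≠ w)
    (hJ : IsClosed J) (hJw : ∀ ζ ∈ sphere (0 : ℂ) 1, Ψ ζ ∈ J → Ψ ζ = w) :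
    ∃ p ∈ ball (0 : ℂ) 1, c < (p * starRingEnd ℂ ω).re ∧
      ∃ ζ ∈ sphere (0 : ℂ) 1, Ψ ζ ≠ w ∧ Ψ p ∈ connectedComponentIn Jᶜ (Ψ ζ) := by
  by_contra! h
  refine h0 (eq_of_forall_mem_arc hΨ hω hc fun ζ hζ hζc ↦ ?_)
  by_contra hne
  have hζs : ζ ∈ sphere (0 : ℂ) 1 := by simpa using hζ
  have hζcl : ζ ∈ closure (ball (0 : ℂ) 1) := by
    rw [closure_ball _ one_ne_zero]
    exact sphere_subset_closedBall hζs
  have : (𝓝[ball 0 1] ζ).NeBot := mem_closure_iff_nhdsWithin_neBot.1 hζcl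
  have hcomp : connectedComponentIn Jᶜ (Ψ ζ) ∈ 𝓝 (Ψ ζ) :=
    hJ.isOpen_compl.connectedComponentIn.mem_nhds
      (mem_connectedComponentIn fun hζJ ↦ hne (hJw ζ hζs hζJ))
  have hΨζ : Tendsto Ψ (𝓝[ball 0 1] ζ) (𝓝 (Ψ ζ)) :=
    (hΨ.continuousOn ζ hζcl).mono_left (nhdsWithin_mono _ subset_closure)
  have hopen : {z : ℂ | c < (z * starRingEnd ℂ ω).re} ∈ 𝓝 ζ :=
    (isOpen_lt continuous_const (by fun_prop)).mem_nhds hζc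
  obtain ⟨p, ⟨hp, hpJ⟩, hpc⟩ := ((eventually_mem_nhdsWithin.and (hΨζ.eventually hcomp)).and
    (mem_nhdsWithin_of_mem_nhds hopen)).exists
  exact h p hp hpc ζ hζs hne hpJ

/-- The boundary map of a conformal map onto a Jordan domain is injective. -/
theorem injOn_sphere_of_eqOn {ψ Ψ f : ℂ → ℂ} (hψ : DifferentiableOn ℂ ψ (ball 0 1))
    (hinj : InjOn ψ (ball 0 1)) (hb : Bornology.IsBounded (ψ '' ball 0 1))
    (hf : ContinuousOn f (sphere 0 1)) (hfi : InjOn f (sphere 0 1))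
    (hfr : frontier (ψ '' ball 0 1) = f '' sphere 0 1) (hΨ : ContinuousOn Ψ (closedBall 0 1))
    (hΨψ : EqOn Ψ ψ (ball 0 1)) : InjOn Ψ (sphere 0 1) := by
  intro a ha b hb' hab
  by_contra hne
  have hmaps := mapsTo_sphere_frontier hψ hinj hΨ hΨψ
  have hΨd : DiffContOnCl ℂ Ψ (ball 0 1) :=
    ⟨hψ.congr hΨψ, by rwa [closure_ball _ one_ne_zero]⟩
  have hdisj : ∀ z ∈ ball (0 : ℂ) 1, Ψ z ∉ frontier (ψ '' ball 0 1) := fun z hz ↦ by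
    rw [(hψ.isOpen_image_of_injOn isOpen_ball (convex_ball _ _).isPreconnected hinj isOpen_ball
      subset_rfl).frontier_eq, hΨψ hz]
    exact fun h ↦ h.2 (mem_image_of_mem ψ hz)
  obtain ⟨ω, hω, c, hc, hchord⟩ :=
    Complex.exists_chord (mem_sphere_zero_iff_norm.1 ha) (mem_sphere_zero_iff_norm.1 hb') hne
  set K := closedBall (0 : ℂ) 1 ∩ {z | (z * starRingEnd ℂ ω).re = c}
  have hJc : IsCompact (Ψ '' K) := ((isCompact_closedBall 0 1).inter_right
    (isClosed_eq (by fun_prop) continuous_const)).image_of_continuousOn (hΨ.mono inter_subset_left)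
  have hJfr : Ψ '' K ∩ frontier (ψ '' ball 0 1) ⊆ {Ψ a} := by
    rintro _ ⟨⟨z, hz, rfl⟩, hzf⟩
    have hz1 : ‖z‖ = 1 := (mem_closedBall_zero_iff.1 hz.1).eq_of_not_lt fun h ↦
      hdisj z (mem_ball_zero_iff.2 h) hzf
    rcases hchord z hz1 hz.2 with rfl | rfl
    · rfl
    · exact hab.symm
  have h0 : Ψ 0 ≠ Ψ a := fun h ↦ hdisj 0 (by simp) (h ▸ hmaps ha)
  have hJw : ∀ ζ ∈ sphere (0 : ℂ) 1, Ψ ζ ∈ Ψ '' K → Ψ ζ = Ψ a := fun ζ hζ hζJ ↦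
    hJfr ⟨hζJ, hmaps hζ⟩
  obtain ⟨p, hp, hpc, ζ, hζ, hζa, hpζ⟩ :=
    exists_mem_connectedComponentIn_of_arc hΨd hω hc.2 h0 hJc.isClosed hJw
  obtain ⟨q, hq, hqc, ξ, hξ, hξa, hqξ⟩ := exists_mem_connectedComponentIn_of_arc (ω := -ω) hΨd
    (by rwa [norm_neg]) (neg_lt.1 hc.1) h0 hJc.isClosed hJw
  obtain ⟨s, hs, hsa⟩ : Ψ a ∈ f '' sphere 0 1 := hfr ▸ hmaps ha
  have hN : IsPreconnected (f '' sphere 0 1 \ {Ψ a}) := by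
    have : f '' sphere 0 1 \ {Ψ a} = f '' (sphere 0 1 \ {s}) := by
      rw [hfi.image_sdiff_subset (singleton_subset_iff.2 hs), image_singleton, hsa]
    rw [this]
    exact (Complex.isPreconnected_sphere_diff_singleton (by simpa using hs)).image _
      (hf.mono sdiff_subset)
  have hNJ : f '' sphere 0 1 \ {Ψ a} ⊆ (Ψ '' K)ᶜ := fun x hx hxJ ↦
    hx.2 (hJfr ⟨hxJ, hfr ▸ hx.1⟩)
  have hξN : Ψ ξ ∈ connectedComponentIn (Ψ '' K)ᶜ (Ψ ζ) :=
    hN.subset_connectedComponentIn ⟨hfr ▸ hmaps hζ, hζa⟩ hNJ ⟨hfr ▸ hmaps hξ, hξa⟩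
  rw [← connectedComponentIn_eq hξN] at hqξ
  have hsub := connectedComponentIn_subset (Ψ '' K)ᶜ (Ψ ζ)
  have hlog : HasContinuousLogQuotient (Ψ '' K) (Ψ p) (Ψ q) :=
    .of_isPreconnected hJc.isClosed isPreconnected_connectedComponentIn
      (disjoint_left.2 fun x hx ↦ hsub hx) hpζ hqξ
  have hpJ := hsub hpζ
  have hqJ := hsub hqξ
  rw [hΨψ hp] at hpJ hlog
  rw [hΨψ hq] at hqJ hlog
  refine not_hasContinuousLogQuotient_of_separates (u := fun z ↦ (z * starRingEnd ℂ ω).re - c)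
    isOpen_ball (convex_ball _ _).isPreconnected hψ hinj rfl hb hJc
    ((subsingleton_singleton.anti hJfr).isPreconnected) (by fun_prop) (fun z hz h ↦ ?_) hp hq
    (sub_pos.2 hpc) ?_ hpJ hqJ hlog
  · exact ⟨z, ⟨ball_subset_closedBall hz, sub_eq_zero.1 h⟩, hΨψ hz⟩
  · simp only [map_neg, mul_neg, Complex.neg_re] at hqc
    linarith

/-- The extension is a bijection onto the closure. -/
theorem bijOn_closedBall_closure {ψ Ψ f : ℂ → ℂ} (hψ : DifferentiableOn ℂ ψ (ball 0 1))
    (hinj : InjOn ψ (ball 0 1)) (hb : Bornology.IsBounded (ψ '' ball 0 1))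
    (hf : ContinuousOn f (sphere 0 1)) (hfi : InjOn f (sphere 0 1))
    (hfr : frontier (ψ '' ball 0 1) = f '' sphere 0 1) (hΨ : ContinuousOn Ψ (closedBall 0 1))
    (hΨψ : EqOn Ψ ψ (ball 0 1)) : BijOn Ψ (closedBall 0 1) (closure (ψ '' ball 0 1)) := by
  have hmaps := mapsTo_sphere_frontier hψ hinj hΨ hΨψ
  have hopen := hψ.isOpen_image_of_injOn isOpen_ball (convex_ball _ _).isPreconnected hinj
    isOpen_ball subset_rfl
  have hdisj : ∀ z ∈ ball (0 : ℂ) 1, ∀ w ∈ sphere (0 : ℂ) 1, Ψ z ≠ Ψ w := fun z hz w hw h ↦ by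
    have := hmaps hw
    rw [hopen.frontier_eq, ← h, hΨψ hz] at this
    exact this.2 (mem_image_of_mem ψ hz)
  have hi : InjOn Ψ (closedBall 0 1) := by
    rw [← ball_union_sphere, injOn_union (disjoint_left.2 fun z hz hz' ↦ hdisj z hz z hz' rfl)]
    exact ⟨hinj.congr hΨψ.symm, injOn_sphere_of_eqOn hψ hinj hb hf hfi hfr hΨ hΨψ, hdisj⟩
  refine ⟨?_, hi, closure_minimal ?_
    ((isCompact_closedBall 0 1).image_of_continuousOn hΨ).isClosed⟩
  · rw [← ball_union_sphere]
    rintro z (hz | hz)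
    · exact subset_closure ⟨z, hz, (hΨψ hz).symm⟩
    · exact frontier_subset_closure (hmaps hz)
  · rintro _ ⟨z, hz, rfl⟩
    exact ⟨z, ball_subset_closedBall hz, hΨψ hz⟩

theorem IsCompact.continuousOn_invFunOn {X Y : Type*} [MetricSpace X] [MetricSpace Y] [Nonempty X]
    {K : Set X} {L : Set Y} (hK : IsCompact K) {f : X → Y} (hf : ContinuousOn f K)
    (hbij : BijOn f K L) : ContinuousOn (Function.invFunOn f K) L := by
  have hinv := hbij.invOn_invFunOn
  refine Metric.continuousOn_iff.2 fun y hy ε hε ↦ ?_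
  obtain ⟨η, hη, h⟩ := hK.exists_dist_lt_of_dist_lt hf hbij.injOn hε
  refine ⟨η, hη, fun x hx hxy ↦ ?_⟩
  refine h _ (Function.invFunOn_mem (hbij.surjOn hx)) _
    (Function.invFunOn_mem (hbij.surjOn hy)) ?_
  rwa [hinv.2 hx, hinv.2 hy]

end

theorem psi_extends_to_homeomorph_of_jordan
    (G : Set ℂ) (hG : IsJordanDomain G)
    (ψ : ℂ → ℂ) (hψd : DifferentiableOn ℂ ψ (Metric.ball (0 : ℂ) 1))
    (hψi : Set.InjOn ψ (Metric.ball (0 : ℂ) 1))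
    (hψs : ψ '' Metric.ball (0 : ℂ) 1 = G) :
    ∃ Ψ Φ : ℂ → ℂ, ContinuousOn Ψ (Metric.closedBall (0 : ℂ) 1) ∧
      Set.EqOn Ψ ψ (Metric.ball (0 : ℂ) 1) ∧
      Set.BijOn Ψ (Metric.closedBall (0 : ℂ) 1) (closure G) ∧
      ContinuousOn Φ (closure G) ∧
      Set.InvOn Φ Ψ (Metric.closedBall (0 : ℂ) 1) (closure G) := by
  subst hψs
  obtain ⟨-, -, hb, _, ⟨f, hf, hfi, rfl⟩, hfr, -⟩ := hG
  obtain ⟨Ψ, hΨ, hΨψ⟩ := exists_continuousOn_closedBall_eqOn hψd hψi hb hf hfi hfr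
  have hbij := bijOn_closedBall_closure hψd hψi hb hf hfi hfr hΨ hΨψ
  exact ⟨Ψ, _, hΨ, hΨψ, hbij, (isCompact_closedBall 0 1).continuousOn_invFunOn hΨ hbij,
    hbij.invOn_invFunOn⟩
end
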